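/- arXiv:2004.14622 — 3 statements merged into one kernel-verified Lean document; each statement's English description precedes it below -/
import Mathlib

section
/- Let Δ_0,…,Δ_n be polytopes in M_ℝ ≅ ℝⁿ. The function μ : N → ℤ defined by μ(v) = MI_M(v|_{Δ_0}, …, v|_{Δ_n}), the mixed integral of the restrictions of the linear function ⟨v,·⟩ to the polytopes Δ_i, is well-defined (integer-valued when the Δ_i are lattice polytopes) and additive: μ(v + v′) = μ(v) + μ(v′) for all v, v′ ∈ N. -/
open Pointwise MeasureTheory

noncomputable section

/-- The embedding `ℤⁿ → ℝⁿ`. -/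
def castZ {n : ℕ} (a : Fin n → ℤ) : Fin n → ℝ := fun j => (a j : ℝ)

/-- The inf-convolution `⊞_{i ∈ J} ρ_i` of the functions `ρ_i` with domains `Δ_i`,
over a subset `J` of the indices. -/
def infConvOn {n : ℕ} (J : Finset (Fin (n + 1))) (Δ : Fin (n + 1) → Set (Fin n → ℝ))
    (ρ : Fin (n + 1) → (Fin n → ℝ) → ℝ) (x : Fin n → ℝ) : ℝ :=
  sInf {t | ∃ y : Fin (n + 1) → Fin n → ℝ,
    (∀ i ∈ J, y i ∈ Δ i) ∧ (∑ i ∈ J, y i) = x ∧ (∑ i ∈ J, ρ i (y i)) = t}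

/-- The mixed integral `MI_M(ρ_0,…,ρ_n)`:
`Σ_{∅ ≠ J ⊆ {0,…,n}} (−1)^{n+1−#J} ∫_{Σ_{i∈J} Δ_i} ⊞_{i∈J} ρ_i  d vol`. -/
def MI (n : ℕ) (Δ : Fin (n + 1) → Set (Fin n → ℝ))
    (ρ : Fin (n + 1) → (Fin n → ℝ) → ℝ) : ℝ :=
  ∑ J ∈ Finset.univ.powerset.filter Finset.Nonempty,
    (-1 : ℝ) ^ (n + 1 - J.card) * ∫ x in (∑ i ∈ J, Δ i), infConvOn J Δ ρ x

open Filter Topology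

section MinkowskiHull

variable {ι : Type*} {n : ℕ}

/-- The Minkowski sum over `i ∈ J` of the lattice polytopes spanned by the `B i`. -/
def minkowskiHull (B : ι → Finset (Fin n → ℤ)) (J : Finset ι) : Set (Fin n → ℝ) :=
  ∑ i ∈ J, convexHull ℝ (castZ '' ↑(B i))

lemma isCompact_minkowskiHull (B : ι → Finset (Fin n → ℤ)) (J : Finset ι) :
    IsCompact (minkowskiHull B J) := by
  classical
  unfold minkowskiHull
  induction J using Finset.induction_on with
  | empty => simp
  | insert i J hi ih =>
    rw [Finset.sum_insert hi]
    exact (((B i).finite_toSet.image _).isCompact_convexHull ℝ).add ih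

lemma convex_minkowskiHull (B : ι → Finset (Fin n → ℤ)) (J : Finset ι) :
    Convex ℝ (minkowskiHull B J) :=
  convex_sum _ fun _ _ => convex_convexHull ℝ _

lemma measurableSet_minkowskiHull (B : ι → Finset (Fin n → ℤ)) (J : Finset ι) :
    MeasurableSet (minkowskiHull B J) :=
  (isCompact_minkowskiHull B J).measurableSet

lemma mem_minkowskiHull {B : ι → Finset (Fin n → ℤ)} {J : Finset ι} {x : Fin n → ℝ} :
    x ∈ minkowskiHull B J ↔ ∃ y : ι → Fin n → ℝ,
      (∀ i ∈ J, y i ∈ convexHull ℝ (castZ '' ↑(B i))) ∧ ∑ i ∈ J, y i = x := by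
  unfold minkowskiHull
  rw [Set.mem_finsetSum]
  constructor
  · rintro ⟨g, hg, h⟩
    exact ⟨g, fun i hi => hg hi, h⟩
  · rintro ⟨g, hg, h⟩
    exact ⟨g, fun {i} hi => hg i hi, h⟩

lemma minkowskiHull_mono {B B' : ι → Finset (Fin n → ℤ)} (h : ∀ i, B i ⊆ B' i) (J : Finset ι) :
    minkowskiHull B J ⊆ minkowskiHull B' J := by
  intro x hx
  rw [mem_minkowskiHull] at hx ⊢
  obtain ⟨y, hy, rfl⟩ := hx
  exact ⟨y, fun i hi => convexHull_mono (Set.image_mono (by exact_mod_cast h i)) (hy i hi), rfl⟩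

lemma minkowskiHull_insert_singleton [DecidableEq ι] {B : ι → Finset (Fin n → ℤ)} {J : Finset ι}
    {i : ι} (hi : i ∉ J) {a : Fin n → ℤ} (ha : B i = {a}) :
    minkowskiHull B (insert i J) = (fun x => x + castZ a) '' minkowskiHull B J := by
  unfold minkowskiHull
  rw [Finset.sum_insert hi, ha, add_comm]
  simp [convexHull_singleton, Set.add_singleton]

lemma continuous_dotProduct_left (u : Fin n → ℝ) : Continuous fun x : Fin n → ℝ => u ⬝ᵥ x := by
  unfold dotProduct
  fun_prop

lemma integrableOn_dotProduct (u : Fin n → ℝ) (B : ι → Finset (Fin n → ℤ)) (J : Finset ι) :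
    IntegrableOn (fun x => u ⬝ᵥ x) (minkowskiHull B J) :=
  (continuous_dotProduct_left u).continuousOn.integrableOn_compact (isCompact_minkowskiHull B J)

lemma le_dotProduct_of_mem_convexHull {S : Finset (Fin n → ℤ)} {u : Fin n → ℝ} {c : ℝ}
    (h : ∀ a ∈ S, c ≤ u ⬝ᵥ castZ a) {x : Fin n → ℝ} (hx : x ∈ convexHull ℝ (castZ '' (S : Set _))) :
    c ≤ u ⬝ᵥ x := by
  have hconv : Convex ℝ {x : Fin n → ℝ | c ≤ u ⬝ᵥ x} :=
    convex_halfSpace_ge ⟨fun x y => dotProduct_add u x y, fun t x => by simp⟩ c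
  refine convexHull_min ?_ hconv hx
  rintro _ ⟨a, ha, rfl⟩
  exact h a ha

lemma dotProduct_le_of_mem_convexHull {S : Finset (Fin n → ℤ)} {u : Fin n → ℝ} {c : ℝ}
    (h : ∀ a ∈ S, u ⬝ᵥ castZ a ≤ c) {x : Fin n → ℝ} (hx : x ∈ convexHull ℝ (castZ '' (S : Set _))) :
    u ⬝ᵥ x ≤ c := by
  have := le_dotProduct_of_mem_convexHull (u := -u) (c := -c) (fun a ha => by simpa using h a ha) hx
  simpa using this

lemma volume_dotProduct_eq_const {u : Fin n → ℝ} (hu : u ≠ 0) (c : ℝ) :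
    volume {x : Fin n → ℝ | u ⬝ᵥ x = c} = 0 := by
  rcases Set.eq_empty_or_nonempty {x : Fin n → ℝ | u ⬝ᵥ x = c} with h | ⟨p, hp⟩
  · simp [h]
  · have hker : volume ((LinearMap.ker (dotProductBilin ℝ ℝ u) : Submodule ℝ (Fin n → ℝ)) :
        Set (Fin n → ℝ)) = 0 := by
      refine Measure.addHaar_submodule _ _ fun htop => hu ?_
      have hmem : u ∈ LinearMap.ker (dotProductBilin ℝ ℝ u) := by
        rw [htop]
        trivial
      exact dotProduct_self_eq_zero.mp (by simpa using hmem)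
    have : {x : Fin n → ℝ | u ⬝ᵥ x = c} = (fun x => x + -p) ⁻¹'
        (LinearMap.ker (dotProductBilin ℝ ℝ u) : Set (Fin n → ℝ)) := by
      ext x
      have hp' : u ⬝ᵥ p = c := hp
      simp [hp', add_neg_eq_zero]
    rw [this, measure_preimage_add_right, hker]

end MinkowskiHull

section RegularSubdivision

variable {ι : Type*} {n : ℕ}

/-- The points of `S` at which the lifting function `w` minus the linear function `u` is
minimal: the face of the lifted configuration with slope `u`. -/
def minFace (w : (Fin n → ℤ) → ℝ) (S : Finset (Fin n → ℤ)) (u : Fin n → ℝ) :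
    Finset (Fin n → ℤ) :=
  S.filter fun a => ∀ b ∈ S, w a - u ⬝ᵥ castZ a ≤ w b - u ⬝ᵥ castZ b

lemma minFace_subset (w : (Fin n → ℤ) → ℝ) (S : Finset (Fin n → ℤ)) (u : Fin n → ℝ) :
    minFace w S u ⊆ S :=
  Finset.filter_subset _ _

lemma mem_minFace {w : (Fin n → ℤ) → ℝ} {S : Finset (Fin n → ℤ)} {u : Fin n → ℝ}
    {a : Fin n → ℤ} : a ∈ minFace w S u ↔
      a ∈ S ∧ ∀ b ∈ S, w a - u ⬝ᵥ castZ a ≤ w b - u ⬝ᵥ castZ b := by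
  simp [minFace]

lemma minFace_nonempty (w : (Fin n → ℤ) → ℝ) {S : Finset (Fin n → ℤ)} (hS : S.Nonempty)
    (u : Fin n → ℝ) : (minFace w S u).Nonempty := by
  obtain ⟨a, ha, h⟩ := S.exists_min_image (fun a => w a - u ⬝ᵥ castZ a) hS
  exact ⟨a, mem_minFace.mpr ⟨ha, h⟩⟩

lemma inf'_eq_of_mem_minFace {w : (Fin n → ℤ) → ℝ} {S : Finset (Fin n → ℤ)} (hS : S.Nonempty)
    {u : Fin n → ℝ} {a : Fin n → ℤ} (ha : a ∈ minFace w S u) :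
    S.inf' hS (fun a => w a - u ⬝ᵥ castZ a) = w a - u ⬝ᵥ castZ a := by
  rw [mem_minFace] at ha
  exact le_antisymm (Finset.inf'_le _ ha.1) (Finset.le_inf' _ _ ha.2)

lemma eventually_minFace_subset (w : (Fin n → ℤ) → ℝ) (S : Finset (Fin n → ℤ))
    (u : Fin n → ℝ) : ∀ᶠ u' in 𝓝 u, minFace w S u' ⊆ minFace w S u := by
  have key : ∀ a ∈ S, ∀ᶠ u' in 𝓝 u, a ∈ minFace w S u' → a ∈ minFace w S u := by
    intro a ha
    by_cases hau : a ∈ minFace w S u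
    · exact Eventually.of_forall fun _ _ => hau
    · obtain ⟨b, hb, hlt⟩ : ∃ b ∈ S, w b - u ⬝ᵥ castZ b < w a - u ⬝ᵥ castZ a := by
        by_contra! h
        exact hau (mem_minFace.mpr ⟨ha, h⟩)
      have hcont : ∀ a, Continuous fun u' : Fin n → ℝ => w a - u' ⬝ᵥ castZ a := by
        intro a
        unfold dotProduct
        fun_prop
      filter_upwards [(hcont b).continuousAt.eventually_lt (hcont a).continuousAt hlt] with u' hu' h
      exact absurd ((mem_minFace.mp h).2 b hb) (not_le.mpr hu')
  filter_upwards [(Filter.eventually_all_finset S).mpr key] with u' h a ha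
  exact h a (minFace_subset _ _ _ ha) ha

/-- The cell of slope `u` of the mixed subdivision induced by the lifting `w`. -/
def mixedCell (w : ι → (Fin n → ℤ) → ℝ) (C : ι → Finset (Fin n → ℤ)) (u : Fin n → ℝ) :
    ι → Finset (Fin n → ℤ) :=
  fun i => minFace (w i) (C i) u

lemma volume_minkowskiHull_mixedCell_inter (w : ι → (Fin n → ℤ) → ℝ)
    (C : ι → Finset (Fin n → ℤ)) (J : Finset ι) {u u' : Fin n → ℝ} (huu' : u ≠ u') :
    volume (minkowskiHull (mixedCell w C u) J ∩ minkowskiHull (mixedCell w C u') J) = 0 := by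
  have hsep : ∀ x ∈ minkowskiHull (mixedCell w C u) J,
      ∀ x' ∈ minkowskiHull (mixedCell w C u') J, (u - u') ⬝ᵥ x' ≤ (u - u') ⬝ᵥ x := by
    intro x hx x' hx'
    rw [mem_minkowskiHull] at hx hx'
    obtain ⟨y, hy, rfl⟩ := hx
    obtain ⟨y', hy', rfl⟩ := hx'
    rw [dotProduct_sum, dotProduct_sum]
    refine Finset.sum_le_sum fun i hi => ?_
    refine dotProduct_le_of_mem_convexHull (fun b hb => ?_) (hy' i hi)
    refine le_dotProduct_of_mem_convexHull (fun a ha => ?_) (hy i hi)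
    obtain ⟨haC, ha⟩ := mem_minFace.mp ha
    obtain ⟨hbC, hb⟩ := mem_minFace.mp hb
    have h1 := ha b hbC
    have h2 := hb a haC
    simp only [sub_dotProduct]
    linarith
  rcases Set.eq_empty_or_nonempty
    (minkowskiHull (mixedCell w C u) J ∩ minkowskiHull (mixedCell w C u') J) with h | ⟨p, hp⟩
  · simp [h]
  · refine measure_mono_null ?_
      (volume_dotProduct_eq_const (sub_ne_zero.mpr huu') ((u - u') ⬝ᵥ p))
    intro x hx
    exact le_antisymm (hsep p hp.1 x hx.2) (hsep x hx.1 p hp.2)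

lemma exists_mem_minkowskiHull_mixedCell [Fintype ι] (w : ι → (Fin n → ℤ) → ℝ)
    {C : ι → Finset (Fin n → ℤ)} (hC : ∀ i, (C i).Nonempty) (J : Finset ι) {x : Fin n → ℝ}
    (hx : x ∈ interior (minkowskiHull C J)) :
    ∃ u, x ∈ minkowskiHull (mixedCell w C u) J := by
  set g : (Fin n → ℝ) → ℝ := fun u =>
    u ⬝ᵥ x + ∑ i ∈ J, (C i).inf' (hC i) fun a => w i a - u ⬝ᵥ castZ a with hg
  have hgcont : Continuous g := by
    refine Continuous.add ?_ (continuous_finsetSum _ fun i _ => ?_)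
    · unfold dotProduct
      fun_prop
    · refine Continuous.finset_inf'_apply (hC i) fun a _ => ?_
      unfold dotProduct
      fun_prop
  obtain ⟨r, hr, hball⟩ := Metric.nhds_basis_closedBall.mem_iff.mp (mem_interior_iff_mem_nhds.mp hx)
  set W : ℝ := ∑ i ∈ J, (C i).sup' (hC i) (w i) with hW
  have hbound : ∀ u, g u ≤ W - r * ‖u‖ := by
    intro u
    set s : Fin n → ℝ := fun j => r * SignType.sign (u j) with hs
    have hy : x + s ∈ minkowskiHull C J := by
      apply hball
      rw [Metric.mem_closedBall, dist_eq_norm, add_sub_cancel_left, pi_norm_le_iff_of_nonneg hr.le]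
      intro j
      rw [hs, Real.norm_eq_abs, abs_mul, abs_of_pos hr]
      refine mul_le_of_le_one_right hr.le ?_
      rcases lt_trichotomy (u j) 0 with h | h | h <;> simp [h]
    have hus : r * ‖u‖ ≤ u ⬝ᵥ s := by
      have h1 : u ⬝ᵥ s = r * ∑ j, |u j| := by
        rw [dotProduct, Finset.mul_sum]
        refine Finset.sum_congr rfl fun j _ => ?_
        rw [hs, ← self_mul_sign (u j)]
        ring
      rw [h1]
      refine mul_le_mul_of_nonneg_left ?_ hr.le
      rw [pi_norm_le_iff_of_nonneg (Finset.sum_nonneg fun _ _ => abs_nonneg _)]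
      intro j
      exact Finset.single_le_sum (f := fun j => |u j|) (fun _ _ => abs_nonneg _) (Finset.mem_univ j)
    obtain ⟨y, hyC, hsum⟩ := mem_minkowskiHull.mp hy
    have h2 : u ⬝ᵥ (x + s) ≤
        ∑ i ∈ J, ((C i).sup' (hC i) (w i) - (C i).inf' (hC i) fun a => w i a - u ⬝ᵥ castZ a) := by
      rw [← hsum, dotProduct_sum]
      refine Finset.sum_le_sum fun i hi => dotProduct_le_of_mem_convexHull (fun a ha => ?_) (hyC i hi)
      have h3 := Finset.inf'_le (fun a => w i a - u ⬝ᵥ castZ a) ha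
      have h4 := Finset.le_sup' (w i) ha
      linarith
    rw [Finset.sum_sub_distrib, dotProduct_add] at h2
    simp only [hg]
    linarith
  have hlim : Tendsto g (cocompact _) atBot := by
    refine tendsto_atBot_mono hbound ?_
    have h1 : Tendsto (fun u : Fin n → ℝ => r * ‖u‖) (cocompact _) atTop :=
      tendsto_norm_cocompact_atTop.const_mul_atTop hr
    simpa [sub_eq_add_neg] using
      tendsto_atBot_add_const_left _ W (tendsto_neg_atTop_atBot.comp h1)
  obtain ⟨u, hu⟩ := hgcont.exists_forall_ge hlim
  refine ⟨u, ?_⟩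
  by_contra hxu
  obtain ⟨f, c, hfc, hcx⟩ := geometric_hahn_banach_closed_point
    (convex_minkowskiHull _ J) (isCompact_minkowskiHull _ J).isClosed hxu
  set v : Fin n → ℝ := fun j => f (Pi.single j 1) with hv
  have hfv : ∀ y, f y = v ⬝ᵥ y := by
    intro y
    conv_lhs => rw [pi_eq_sum_univ' y]
    simp only [map_sum, map_smul, dotProduct, hv, smul_eq_mul]
    refine Finset.sum_congr rfl fun j _ => ?_
    rw [mul_comm]
  have hlim' : Tendsto (fun ε : ℝ => u + ε • v) (𝓝[>] 0) (𝓝 u) := by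
    have : Continuous fun ε : ℝ => u + ε • v := by fun_prop
    simpa using (this.tendsto 0).mono_left nhdsWithin_le_nhds
  obtain ⟨ε, hsub, hε⟩ := ((hlim'.eventually (Filter.eventually_all.mpr fun i =>
    eventually_minFace_subset (w i) (C i) u)).and self_mem_nhdsWithin).exists
  choose a ha using fun i => minFace_nonempty (w i) (hC i) (u + ε • v)
  have hgu : g u = u ⬝ᵥ x + ∑ i ∈ J, (w i (a i) - u ⬝ᵥ castZ (a i)) := by
    simp only [hg]
    congr 1
    exact Finset.sum_congr rfl fun i _ => inf'_eq_of_mem_minFace _ (hsub i (ha i))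
  have hgu' : g (u + ε • v) =
      (u + ε • v) ⬝ᵥ x + ∑ i ∈ J, (w i (a i) - (u + ε • v) ⬝ᵥ castZ (a i)) := by
    simp only [hg]
    congr 1
    exact Finset.sum_congr rfl fun i _ => inf'_eq_of_mem_minFace _ (ha i)
  have hmem : ∑ i ∈ J, castZ (a i) ∈ minkowskiHull (mixedCell w C u) J :=
    mem_minkowskiHull.mpr ⟨fun i => castZ (a i), fun i _ =>
      subset_convexHull ℝ _ ⟨a i, hsub i (ha i), rfl⟩, rfl⟩
  have h1 : v ⬝ᵥ ∑ i ∈ J, castZ (a i) < v ⬝ᵥ x := by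
    rw [← hfv, ← hfv]
    exact (hfc _ hmem).trans hcx
  have h2 : g (u + ε • v) = g u + ε * (v ⬝ᵥ x - v ⬝ᵥ ∑ i ∈ J, castZ (a i)) := by
    rw [hgu, hgu', dotProduct_sum]
    simp only [add_dotProduct, smul_dotProduct, smul_eq_mul, Finset.sum_sub_distrib,
      Finset.sum_add_distrib, ← Finset.mul_sum]
    ring
  have h3 : 0 < ε * (v ⬝ᵥ x - v ⬝ᵥ ∑ i ∈ J, castZ (a i)) := mul_pos hε (sub_pos.mpr h1)
  have h4 := hu (u + ε • v)
  linarith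

end RegularSubdivision

section GenericLifting

lemma exists_linearIndependent_rat_real (E : Type) [Countable E] :
    ∃ w : E → ℝ, LinearIndependent ℚ w := by
  have hcard : Cardinal.mk E ≤ Cardinal.mk (Module.Basis.ofVectorSpaceIndex ℚ ℝ) := by
    rw [(Module.Basis.ofVectorSpace ℚ ℝ).mk_eq_rank'', Real.rank_rat_real]
    exact (Cardinal.mk_le_aleph0).trans Cardinal.aleph0_le_continuum
  obtain ⟨f⟩ := hcard
  exact ⟨_, (Module.Basis.ofVectorSpace ℚ ℝ).linearIndependent.comp f f.injective⟩

lemma sum_card_mixedCell_le {ι : Type*} [Fintype ι] {n : ℕ} {w : (Σ _ : ι, Fin n → ℤ) → ℝ}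
    (hw : LinearIndependent ℚ w) (C : ι → Finset (Fin n → ℤ)) (u : Fin n → ℝ) :
    ∑ i, (mixedCell (fun i a => w ⟨i, a⟩) C u i).card ≤ Fintype.card ι + n := by
  classical
  by_contra! hlt
  set S := Finset.univ.sigma (mixedCell (fun i a => w ⟨i, a⟩) C u) with hS
  let V : S → (ι → ℚ) × (Fin n → ℚ) := fun s => (Pi.single s.1.1 1, fun j => (s.1.2 j : ℚ))
  have hV : ¬ LinearIndependent ℚ V := by
    intro h
    have h1 := h.fintype_card_le_finrank
    rw [Fintype.card_coe, hS, Finset.card_sigma] at h1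
    simp only [Module.finrank_prod, Module.finrank_fintype_fun_eq_card, Fintype.card_fin] at h1
    omega
  obtain ⟨c, hc, s₀, hs₀⟩ := Fintype.not_linearIndependent_iff.mp hV
  have hc1 : ∀ i, ∑ s, c s * (Pi.single s.1.1 1 : ι → ℚ) i = 0 := by
    intro i
    have := congrFun (congrArg Prod.fst hc) i
    simpa [V, Prod.fst_sum, Finset.sum_apply] using this
  have hc2 : ∀ j, ∑ s, c s * (s.1.2 j : ℚ) = 0 := by
    intro j
    have := congrFun (congrArg Prod.snd hc) j
    simpa [V, Prod.snd_sum, Finset.sum_apply] using this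
  obtain ⟨m, hm⟩ : ∃ m : ι → ℝ, ∀ s : S, w s = m s.1.1 + u ⬝ᵥ castZ s.1.2 := by
    have : ∀ i, ∃ m : ℝ, ∀ a ∈ mixedCell (fun i a => w ⟨i, a⟩) C u i,
        w ⟨i, a⟩ = m + u ⬝ᵥ castZ a := by
      intro i
      by_cases h : (C i).Nonempty
      · refine ⟨(C i).inf' h fun a => w ⟨i, a⟩ - u ⬝ᵥ castZ a, fun a ha => ?_⟩
        rw [inf'_eq_of_mem_minFace (w := fun a => w ⟨i, a⟩) h ha]
        ring
      · refine ⟨0, fun a ha => absurd ⟨a, minFace_subset _ _ _ ha⟩ h⟩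
    choose m hm using this
    exact ⟨m, fun s => hm _ _ (Finset.mem_sigma.mp s.2).2⟩
  have hrel : ∑ s, c s • w s = 0 := by
    have h1 : ∑ s : S, (c s : ℝ) * m s.1.1 = 0 := by
      have : ∀ s : S, (c s : ℝ) * m s.1.1 =
          ∑ i, m i * ((c s * (Pi.single s.1.1 1 : ι → ℚ) i : ℚ) : ℝ) := by
        intro s
        rw [Finset.sum_eq_single s.1.1]
        · simp [mul_comm]
        · intro i _ hi
          simp [hi]
        · simp
      simp_rw [this]
      rw [Finset.sum_comm]
      refine Finset.sum_eq_zero fun i _ => ?_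
      rw [← Finset.mul_sum, ← Rat.cast_sum, hc1, Rat.cast_zero, mul_zero]
    have h2 : ∑ s : S, (c s : ℝ) * (u ⬝ᵥ castZ s.1.2) = 0 := by
      have : ∀ s : S, (c s : ℝ) * (u ⬝ᵥ castZ s.1.2) =
          ∑ j, u j * ((c s * (s.1.2 j : ℚ) : ℚ) : ℝ) := by
        intro s
        rw [dotProduct, Finset.mul_sum]
        refine Finset.sum_congr rfl fun j _ => ?_
        simp only [castZ, Rat.cast_mul, Rat.cast_intCast]
        ring
      simp_rw [this]
      rw [Finset.sum_comm]
      refine Finset.sum_eq_zero fun j _ => ?_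
      rw [← Finset.mul_sum, ← Rat.cast_sum, hc2, Rat.cast_zero, mul_zero]
    simp_rw [Rat.smul_def, hm, mul_add, Finset.sum_add_distrib, h1, h2, add_zero]
  exact hs₀ (Fintype.linearIndependent_iff.mp
    (hw.comp (Subtype.val : S → _) Subtype.val_injective) c hrel s₀)

lemma finite_range_mixedCell {ι : Type*} [Finite ι] {n : ℕ} (w : ι → (Fin n → ℤ) → ℝ)
    (C : ι → Finset (Fin n → ℤ)) : (Set.range (mixedCell w C)).Finite := by
  classical
  have := Fintype.ofFinite ι
  refine (Fintype.piFinset fun i => (C i).powerset).finite_toSet.subset ?_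
  rintro _ ⟨u, rfl⟩
  simp only [Finset.mem_coe, Fintype.mem_piFinset, Finset.mem_powerset]
  exact fun i => minFace_subset _ _ _

/-- A fine mixed subdivision: finitely many families of subconfigurations of total size at most
the number of polytopes plus the dimension, which dissect all the partial Minkowski sums. -/
lemma exists_fine_mixed_subdivision {ι : Type} [Fintype ι] {n : ℕ} {C : ι → Finset (Fin n → ℤ)}
    (hC : ∀ i, (C i).Nonempty) :
    ∃ T : Finset (ι → Finset (Fin n → ℤ)),
      (∀ B ∈ T, (∀ i, (B i).Nonempty) ∧ ∑ i, (B i).card ≤ Fintype.card ι + n) ∧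
      ∀ (J : Finset ι) (u : Fin n → ℝ), ∫ x in minkowskiHull C J, u ⬝ᵥ x =
        ∑ B ∈ T, ∫ x in minkowskiHull B J, u ⬝ᵥ x := by
  obtain ⟨w', hw'⟩ := exists_linearIndependent_rat_real (Σ _ : ι, Fin n → ℤ)
  set w : ι → (Fin n → ℤ) → ℝ := fun i a => w' ⟨i, a⟩ with hw
  have hfin := finite_range_mixedCell w C
  refine ⟨hfin.toFinset, ?_, ?_⟩
  · intro B hB
    obtain ⟨u, rfl⟩ := hfin.mem_toFinset.mp hB
    exact ⟨fun i => minFace_nonempty _ (hC i) u, sum_card_mixedCell_le hw' C u⟩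
  intro J v
  have hsub : (⋃ B : hfin.toFinset, minkowskiHull B.1 J) ⊆ minkowskiHull C J := by
    refine Set.iUnion_subset fun ⟨B, hB⟩ => ?_
    obtain ⟨u, rfl⟩ := hfin.mem_toFinset.mp hB
    exact minkowskiHull_mono (fun i => minFace_subset _ _ _) J
  have hae : (⋃ B : hfin.toFinset, minkowskiHull B.1 J) =ᵐ[volume] minkowskiHull C J := by
    refine hsub.eventuallyLE.antisymm (ae_le_set.mpr (measure_mono_null ?_
      ((convex_minkowskiHull C J).addHaar_frontier volume)))
    rintro x ⟨hxC, hx⟩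
    refine ⟨subset_closure hxC, fun hint => hx ?_⟩
    obtain ⟨u, hu⟩ := exists_mem_minkowskiHull_mixedCell w hC J hint
    exact Set.mem_iUnion.mpr ⟨⟨_, hfin.mem_toFinset.mpr ⟨u, rfl⟩⟩, hu⟩
  rw [← setIntegral_congr_set hae, integral_iUnion_ae, tsum_fintype,
    Finset.sum_coe_sort hfin.toFinset fun B => ∫ x in minkowskiHull B J, v ⬝ᵥ x]
  · exact fun B => (measurableSet_minkowskiHull _ _).nullMeasurableSet
  · rintro ⟨B, hB⟩ ⟨B', hB'⟩ hne
    obtain ⟨u, rfl⟩ := hfin.mem_toFinset.mp hB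
    obtain ⟨u', rfl⟩ := hfin.mem_toFinset.mp hB'
    refine volume_minkowskiHull_mixedCell_inter w C J ?_
    rintro rfl
    exact hne rfl
  · exact (integrableOn_dotProduct v C J).mono_set hsub

end GenericLifting

section CellContribution

variable {n : ℕ}

lemma sum_powerset_insert_neg_one_pow {ι : Type*} [DecidableEq ι] {s : Finset ι} {i : ι}
    (hi : i ∉ s) (F : Finset ι → ℝ) :
    ∑ J ∈ (insert i s).powerset, (-1 : ℝ) ^ (s.card + 1 - J.card) * F J =
      ∑ J ∈ s.powerset, (-1 : ℝ) ^ (s.card - J.card) * (F (insert i J) - F J) := by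
  rw [Finset.sum_powerset_insert hi, ← Finset.sum_add_distrib]
  refine Finset.sum_congr rfl fun J hJ => ?_
  rw [Finset.mem_powerset] at hJ
  have hle := Finset.card_le_card hJ
  rw [Finset.card_insert_of_notMem fun h => hi (hJ h), Nat.sub_add_comm hle,
    Nat.add_sub_add_right, pow_succ]
  ring

lemma volume_real_parallelepiped_castZ (a : Fin n → Fin n → ℤ) :
    volume.real (parallelepiped fun k => castZ (a k)) = |((Matrix.of a).det : ℝ)| := by
  have hvol : (volume : Measure (Fin n → ℝ)) = (Pi.basisFun ℝ (Fin n)).addHaar := by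
    rw [← addHaarMeasure_eq_volume_pi, ← Module.Basis.parallelepiped_basisFun,
      ← Module.Basis.addHaar_def]
  rw [hvol, measureReal_def, Measure.addHaar_parallelepiped, ENNReal.toReal_ofReal (abs_nonneg _),
    Pi.basisFun_det_apply]
  congr 1
  have := (Int.castRingHom ℝ).map_det (Matrix.of a)
  rw [eq_intCast] at this
  rw [this]
  rfl

lemma convexHull_castZ_pair (a b : Fin n → ℤ) :
    convexHull ℝ (castZ '' (({a, b} : Finset (Fin n → ℤ)) : Set (Fin n → ℤ))) =
      {castZ a} + segment ℝ 0 (castZ (b - a)) := by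
  have hcast : castZ (b - a) = castZ b - castZ a := by
    ext j
    simp [castZ]
  rw [Finset.coe_pair, Set.image_pair, convexHull_pair, hcast, Set.singleton_add,
    segment_translate_image]
  simp

lemma exists_int_volume_real_minkowskiHull {B : Fin (n + 1) → Finset (Fin n → ℤ)}
    {J : Finset (Fin (n + 1))} {i₀ : Fin (n + 1)} (hi₀ : i₀ ∉ J)
    (hB : ∀ i ∈ J, (B i).card = 2) : ∃ k : ℤ, volume.real (minkowskiHull B J) = k := by
  have hpair : ∀ i, ∃ a b, i ∈ J → B i = {a, b} := by
    intro i
    by_cases hi : i ∈ J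
    · obtain ⟨a, b, -, hab⟩ := Finset.card_eq_two.mp (hB i hi)
      exact ⟨a, b, fun _ => hab⟩
    · exact ⟨0, 0, fun h => absurd h hi⟩
  choose a b hab using hpair
  have hsum : minkowskiHull B J = {∑ i ∈ J, castZ (a i)} + parallelepiped fun k : Fin n =>
      castZ (if i₀.succAbove k ∈ J then b (i₀.succAbove k) - a (i₀.succAbove k) else 0) := by
    have h1 : minkowskiHull B J =
        ∑ i ∈ J, ({castZ (a i)} + segment ℝ 0 (castZ (b i - a i))) := by
      unfold minkowskiHull
      refine Finset.sum_congr rfl fun i hi => ?_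
      rw [hab i hi, convexHull_castZ_pair]
    rw [h1, Finset.sum_add_distrib, Set.finsetSum_singleton, parallelepiped_eq_sum_segment]
    congr 1
    set G : Fin (n + 1) → Set (Fin n → ℝ) := fun i =>
      segment ℝ 0 (castZ (if i ∈ J then b i - a i else 0)) with hG
    have hG0 : ∀ i ∉ J, G i = 0 := by
      intro i hi
      have : castZ (0 : Fin n → ℤ) = 0 := by
        ext j
        simp [castZ]
      simp [hG, hi, this, Set.singleton_zero]
    calc ∑ i ∈ J, segment ℝ 0 (castZ (b i - a i)) = ∑ i ∈ J, G i :=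
          Finset.sum_congr rfl fun i hi => by simp [hG, hi]
      _ = ∑ i, G i := Finset.sum_subset (Finset.subset_univ J) fun i _ hi => hG0 i hi
      _ = ∑ k, G (i₀.succAbove k) := by rw [Fin.sum_univ_succAbove _ i₀, hG0 i₀ hi₀, zero_add]
  refine ⟨|(Matrix.of fun k : Fin n => if i₀.succAbove k ∈ J then
    b (i₀.succAbove k) - a (i₀.succAbove k) else 0).det|, ?_⟩
  rw [hsum, Set.singleton_add, measureReal_def, Set.image_add_left, measure_preimage_add,
    ← measureReal_def, volume_real_parallelepiped_castZ]
  simp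

lemma setIntegral_minkowskiHull_insert_sub {ι : Type*} [DecidableEq ι]
    {B : ι → Finset (Fin n → ℤ)} {J : Finset ι} {i : ι} (hi : i ∉ J) {a : Fin n → ℤ}
    (ha : B i = {a}) (u : Fin n → ℝ) :
    (∫ x in minkowskiHull B (insert i J), u ⬝ᵥ x) - ∫ x in minkowskiHull B J, u ⬝ᵥ x =
      u ⬝ᵥ castZ a * volume.real (minkowskiHull B J) := by
  rw [minkowskiHull_insert_singleton hi ha,
    (measurePreserving_add_right volume (castZ a)).setIntegral_image_emb
      (measurableEmbedding_addRight (castZ a))]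
  simp_rw [dotProduct_add]
  rw [integral_add (integrableOn_dotProduct u B J)
    (integrableOn_const (isCompact_minkowskiHull B J).measure_ne_top), setIntegral_const,
    smul_eq_mul]
  ring

lemma volume_real_minkowskiHull_insert {ι : Type*} [DecidableEq ι]
    {B : ι → Finset (Fin n → ℤ)} {J : Finset ι} {i : ι} (hi : i ∉ J) {a : Fin n → ℤ}
    (ha : B i = {a}) :
    volume.real (minkowskiHull B (insert i J)) = volume.real (minkowskiHull B J) := by
  rw [minkowskiHull_insert_singleton hi ha, measureReal_def, measureReal_def, Set.image_add_right,
    measure_preimage_add_right]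

lemma exists_int_sum_volume_real {B : Fin (n + 1) → Finset (Fin n → ℤ)}
    (hne : ∀ i, (B i).Nonempty) (hcard : ∑ i, (B i).card ≤ n + 1 + n) {i₀ : Fin (n + 1)} :
    ∃ k : ℤ, ∑ J ∈ (Finset.univ.erase i₀).powerset, (-1 : ℝ) ^ (n - J.card) *
      volume.real (minkowskiHull B J) = k := by
  by_cases hone : ∃ i ∈ Finset.univ.erase i₀, (B i).card = 1
  · obtain ⟨i, hi, hBi⟩ := hone
    obtain ⟨a, ha⟩ := Finset.card_eq_one.mp hBi
    refine ⟨0, ?_⟩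
    have hn : ((Finset.univ.erase i₀).erase i).card + 1 = n := by
      rw [Finset.card_erase_add_one hi, Finset.card_erase_of_mem (Finset.mem_univ _)]
      simp
    have h := sum_powerset_insert_neg_one_pow
      (Finset.notMem_erase i (Finset.univ.erase i₀)) fun J => volume.real (minkowskiHull B J)
    rw [Finset.insert_erase hi, hn] at h
    rw [h, Int.cast_zero]
    refine Finset.sum_eq_zero fun J hJ => ?_
    rw [volume_real_minkowskiHull_insert
      (fun hiJ => Finset.notMem_erase i _ (Finset.mem_powerset.mp hJ hiJ)) ha, sub_self, mul_zero]
  · push Not at hone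
    have htwo : ∀ i ∈ Finset.univ.erase i₀, 2 ≤ (B i).card := by
      intro i hi
      have h1 := hone i hi
      have h2 := (hne i).card_pos
      omega
    have heq : ∀ i ∈ Finset.univ.erase i₀, 2 = (B i).card := by
      refine (Finset.sum_eq_sum_iff_of_le htwo).mp (le_antisymm (Finset.sum_le_sum htwo) ?_)
      have h1 := Finset.add_sum_erase Finset.univ (fun i => (B i).card) (Finset.mem_univ i₀)
      have h2 := (hne i₀).card_pos
      rw [Finset.sum_const, Finset.card_erase_of_mem (Finset.mem_univ _)]
      simp only [Finset.card_univ, Fintype.card_fin, smul_eq_mul] at h1 ⊢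
      omega
    have hint : ∀ J ∈ (Finset.univ.erase i₀).powerset,
        ∃ k : ℤ, volume.real (minkowskiHull B J) = k := by
      intro J hJ
      rw [Finset.mem_powerset] at hJ
      exact exists_int_volume_real_minkowskiHull
        (fun h => Finset.notMem_erase i₀ _ (hJ h)) fun i hi => (heq i (hJ hi)).symm
    choose! k hk using hint
    refine ⟨∑ J ∈ (Finset.univ.erase i₀).powerset, (-1) ^ (n - J.card) * k J, ?_⟩
    push_cast
    exact Finset.sum_congr rfl fun J hJ => by rw [hk J hJ]

lemma exists_int_sum_setIntegral_minkowskiHull {B : Fin (n + 1) → Finset (Fin n → ℤ)}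
    (hne : ∀ i, (B i).Nonempty) (hcard : ∑ i, (B i).card ≤ n + 1 + n) (v : Fin n → ℤ) :
    ∃ k : ℤ, ∑ J ∈ Finset.univ.powerset, (-1 : ℝ) ^ (n + 1 - J.card) *
      ∫ x in minkowskiHull B J, castZ v ⬝ᵥ x = k := by
  obtain ⟨i₀, hi₀⟩ : ∃ i, (B i).card = 1 := by
    by_contra! h
    have htwo : ∀ i ∈ Finset.univ, 2 ≤ (B i).card := by
      intro i _
      have h1 := h i
      have h2 := (hne i).card_pos
      omega
    have := Finset.sum_le_sum htwo
    simp only [Finset.sum_const, Finset.card_univ, Fintype.card_fin, smul_eq_mul] at this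
    omega
  obtain ⟨a, ha⟩ := Finset.card_eq_one.mp hi₀
  obtain ⟨k, hk⟩ := exists_int_sum_volume_real hne hcard (i₀ := i₀)
  have hn : (Finset.univ.erase i₀).card = n := by
    rw [Finset.card_erase_of_mem (Finset.mem_univ _)]
    simp
  have h := sum_powerset_insert_neg_one_pow (Finset.notMem_erase i₀ Finset.univ)
    fun J => ∫ x in minkowskiHull B J, castZ v ⬝ᵥ x
  rw [Finset.insert_erase (Finset.mem_univ _), hn] at h
  refine ⟨(v ⬝ᵥ a) * k, ?_⟩
  rw [h, Int.cast_mul, ← hk, Finset.mul_sum]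
  refine Finset.sum_congr rfl fun J hJ => ?_
  rw [setIntegral_minkowskiHull_insert_sub
    (fun hJ' => Finset.notMem_erase i₀ _ (Finset.mem_powerset.mp hJ hJ')) ha]
  have hdot : castZ v ⬝ᵥ castZ a = ((v ⬝ᵥ a : ℤ) : ℝ) := by
    simp [dotProduct, castZ]
  rw [hdot]
  ring

end CellContribution

section MixedIntegral

variable {n : ℕ}

lemma infConvOn_dotProduct {J : Finset (Fin (n + 1))} {C : Fin (n + 1) → Finset (Fin n → ℤ)}
    (u : Fin n → ℝ) {x : Fin n → ℝ} (hx : x ∈ minkowskiHull C J) :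
    infConvOn J (fun i => convexHull ℝ (castZ '' ↑(C i))) (fun _ x => u ⬝ᵥ x) x = u ⬝ᵥ x := by
  unfold infConvOn
  have : {t | ∃ y : Fin (n + 1) → Fin n → ℝ, (∀ i ∈ J, y i ∈ convexHull ℝ (castZ '' ↑(C i))) ∧
      ∑ i ∈ J, y i = x ∧ ∑ i ∈ J, u ⬝ᵥ y i = t} = {u ⬝ᵥ x} := by
    ext t
    constructor
    · rintro ⟨y, -, rfl, rfl⟩
      exact (dotProduct_sum _ _ _).symm
    · rintro rfl
      obtain ⟨y, hy, rfl⟩ := mem_minkowskiHull.mp hx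
      exact ⟨y, hy, rfl, (dotProduct_sum _ _ _).symm⟩
  rw [this, csInf_singleton]

lemma MI_dotProduct (C : Fin (n + 1) → Finset (Fin n → ℤ)) (u : Fin n → ℝ) :
    MI n (fun i => convexHull ℝ (castZ '' ↑(C i))) (fun _ x => u ⬝ᵥ x) =
      ∑ J ∈ Finset.univ.powerset, (-1 : ℝ) ^ (n + 1 - J.card) *
        ∫ x in minkowskiHull C J, u ⬝ᵥ x := by
  unfold MI
  rw [Finset.sum_filter]
  refine Finset.sum_congr rfl fun J _ => ?_
  split_ifs with hJ
  · congr 1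
    exact setIntegral_congr_fun (measurableSet_minkowskiHull C J)
      fun x hx => infConvOn_dotProduct u hx
  · rw [Finset.not_nonempty_iff_eq_empty.mp hJ]
    simp [minkowskiHull, ← Set.singleton_zero]

end MixedIntegral

/-- For lattice polytopes `Δ_0,…,Δ_n ⊂ ℝⁿ`, the function `μ(v) = MI(v|_{Δ_0},…,v|_{Δ_n})`
on the dual lattice `N = ℤⁿ` is integer-valued and additive. -/
theorem stmt6 (n : ℕ) (C : Fin (n + 1) → Finset (Fin n → ℤ)) (hC : ∀ i, (C i).Nonempty) :
    (∀ v : Fin n → ℤ, ∃ k : ℤ,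
      MI n (fun i => convexHull ℝ (castZ '' ↑(C i)))
        (fun _ x => ∑ j, (v j : ℝ) * x j) = k) ∧
    (∀ v v' : Fin n → ℤ,
      MI n (fun i => convexHull ℝ (castZ '' ↑(C i)))
        (fun _ x => ∑ j, ((v j + v' j : ℤ) : ℝ) * x j)
      = MI n (fun i => convexHull ℝ (castZ '' ↑(C i)))
          (fun _ x => ∑ j, (v j : ℝ) * x j)
        + MI n (fun i => convexHull ℝ (castZ '' ↑(C i)))
            (fun _ x => ∑ j, (v' j : ℝ) * x j)) := by
  refine ⟨fun v => ?_, fun v v' => ?_⟩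
  · change ∃ k : ℤ, MI n (fun i => convexHull ℝ (castZ '' ↑(C i))) (fun _ x => castZ v ⬝ᵥ x) = k
    obtain ⟨T, hT, hint⟩ := exists_fine_mixed_subdivision hC
    have hcell : ∀ B ∈ T, ∃ k : ℤ, ∑ J ∈ Finset.univ.powerset, (-1 : ℝ) ^ (n + 1 - J.card) *
        ∫ x in minkowskiHull B J, castZ v ⬝ᵥ x = k := fun B hB =>
      exists_int_sum_setIntegral_minkowskiHull (hT B hB).1 (by simpa using (hT B hB).2) v
    choose! k hk using hcell
    refine ⟨∑ B ∈ T, k B, ?_⟩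
    rw [MI_dotProduct, Int.cast_sum]
    simp_rw [hint, Finset.mul_sum]
    rw [Finset.sum_comm]
    exact Finset.sum_congr rfl hk
  · change MI n (fun i => convexHull ℝ (castZ '' ↑(C i))) (fun _ x => castZ (v + v') ⬝ᵥ x) =
      MI n (fun i => convexHull ℝ (castZ '' ↑(C i))) (fun _ x => castZ v ⬝ᵥ x) +
        MI n (fun i => convexHull ℝ (castZ '' ↑(C i))) (fun _ x => castZ v' ⬝ᵥ x)
    have hadd : castZ (v + v') = castZ v + castZ v' := by
      ext j
      simp [castZ]
    simp_rw [MI_dotProduct, hadd, add_dotProduct]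
    rw [← Finset.sum_add_distrib]
    refine Finset.sum_congr rfl fun J _ => ?_
    rw [integral_add (integrableOn_dotProduct _ C J) (integrableOn_dotProduct _ C J), mul_add]
end
end

section
/- Let 𝒞_i ⊂ M ≅ ℤⁿ, i = 1,…,s, be nonempty finite sets with Δ_i = conv(𝒞_i) and Δ = Σ_i Δ_i. For ν = (ν_1,…,ν_s) ∈ ∏_i ℝ^{𝒞_i}, let ϑ_{ν_i} : Δ_i → ℝ be the convex piecewise affine function parametrizing the lower envelope of conv({(a, ν_{i,a}) : a ∈ 𝒞_i}) ⊂ M_ℝ × ℝ, and let Θ_ν = ϑ_{ν_1} ⊞ ⋯ ⊞ ϑ_{ν_s}. There exists a finite union of hyperplanes W ⊂ ∏_i ℝ^{𝒞_i}, not containing the image of the linear map A : N^s → ∏_i ℝ^{𝒞_i}, A(v_1,…,v_s) = (⟨v_i,a⟩)_{i,a}, such that for every ν ∉ W the mixed subdivision S(Θ_ν) of Δ is tight, i.e. every n-dimensional cell C of S(Θ_ν) satisfies Σ_{i=1}^s dim(C_i) = n, where C_i are the components of C. -/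
open Pointwise

noncomputable section

/-- The standard pairing on `ℝⁿ`. -/
def dot {n : ℕ} (v x : Fin n → ℝ) : ℝ := ∑ i, v i * x i

/-- The epigraph of a function `ψ` defined on `Λ`. -/
def epigraph {n : ℕ} (Λ : Set (Fin n → ℝ)) (ψ : (Fin n → ℝ) → ℝ) :
    Set ((Fin n → ℝ) × ℝ) :=
  {p | p.1 ∈ Λ ∧ ψ p.1 ≤ p.2}

/-- The support value `h_S(v,1) = inf {⟨v,x⟩ + z : (x,z) ∈ S}`. -/
def suppVal {n : ℕ} (S : Set ((Fin n → ℝ) × ℝ)) (v : Fin n → ℝ) : ℝ :=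
  sInf ((fun p => dot v p.1 + p.2) '' S)

/-- The cell `C(ψ,v)`: the projection to `M_ℝ` of the face of the epigraph of `ψ`
in the direction `(v,1)`. -/
def cell {n : ℕ} (Λ : Set (Fin n → ℝ)) (ψ : (Fin n → ℝ) → ℝ) (v : Fin n → ℝ) :
    Set (Fin n → ℝ) :=
  Prod.fst '' {p | p ∈ epigraph Λ ψ ∧ dot v p.1 + p.2 = suppVal (epigraph Λ ψ) v}

/-- A convex polyhedron: a finite intersection of closed halfspaces. -/
def IsPolyhedron {n : ℕ} (Λ : Set (Fin n → ℝ)) : Prop :=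
  ∃ F : Finset ((Fin n → ℝ) × ℝ), Λ = {x | ∀ p ∈ F, dot p.1 x ≤ p.2}

/-- A convex piecewise affine function on `Λ`: the max of finitely many affine functions. -/
def IsCPA {n : ℕ} (Λ : Set (Fin n → ℝ)) (ψ : (Fin n → ℝ) → ℝ) : Prop :=
  ∃ F : Finset ((Fin n → ℝ) × ℝ), ∃ hF : F.Nonempty,
    ∀ x ∈ Λ, ψ x = F.sup' hF fun p => dot p.1 x + p.2

/-- The inf-convolution `ψ_1 ⊞ ⋯ ⊞ ψ_s` of functions `ψ i` with domains `Λ i`. -/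
def infConv {n s : ℕ} (Λ : Fin s → Set (Fin n → ℝ)) (ψ : Fin s → (Fin n → ℝ) → ℝ)
    (x : Fin n → ℝ) : ℝ :=
  sInf {t | ∃ y : Fin s → Fin n → ℝ,
    (∀ i, y i ∈ Λ i) ∧ (∑ i, y i) = x ∧ (∑ i, ψ i (y i)) = t}

/-- The `i`-th component of a cell `C` of the mixed subdivision: the image under the `i`-th
projection of the set of decomposition tuples realizing the infimum of the inf-convolution. -/
def comp {n s : ℕ} (Λ : Fin s → Set (Fin n → ℝ)) (ψ : Fin s → (Fin n → ℝ) → ℝ)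
    (C : Set (Fin n → ℝ)) (i : Fin s) : Set (Fin n → ℝ) :=
  (fun y => y i) '' {y : Fin s → Fin n → ℝ |
    (∀ j, y j ∈ Λ j) ∧ (∑ j, y j) ∈ C ∧ infConv Λ ψ (∑ j, y j) = ∑ j, ψ j (y j)}

/-- The dimension of a subset of a real vector space: the dimension of its affine span. -/
def dimAff {V : Type*} [AddCommGroup V] [Module ℝ V] (S : Set V) : ℕ :=
  Module.finrank ℝ (affineSpan ℝ S).direction

/-- The convex piecewise affine function `ϑ_ν` parametrizing the lower envelope of the
convex hull of the lifted points `{(a, ν_a) : a ∈ S}`. -/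
def lowerEnv {n : ℕ} (S : Finset (Fin n → ℤ)) (ν : {a // a ∈ S} → ℝ)
    (x : Fin n → ℝ) : ℝ :=
  sInf {t | (x, t) ∈ convexHull ℝ
    (Set.range fun a : {a // a ∈ S} => ((castZ (a : Fin n → ℤ), ν a) : (Fin n → ℝ) × ℝ))}

/-- A hyperplane through the origin in a real vector space. -/
def IsHyperplane {V : Type*} [AddCommGroup V] [Module ℝ V] (H : Set V) : Prop :=
  ∃ f : V →ₗ[ℝ] ℝ, f ≠ 0 ∧ H = {x | f x = 0}

/-- The image of the linear map `A : N^s → ℝ^𝒞`, `A(v_1,…,v_s) = (⟨v_i,a⟩)_{i,a}`. -/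
def AImage {n s : ℕ} (C : Fin s → Finset (Fin n → ℤ)) :
    Set (∀ i : Fin s, {a // a ∈ C i} → ℝ) :=
  {ν | ∃ w : Fin s → Fin n → ℤ, ∀ i a, ν i a = ∑ j, (w i j : ℝ) * ((a : Fin n → ℤ) j : ℝ)}

/-- The mixed subdivision `S(Θ_ν)` is tight: every `n`-dimensional cell has components
whose dimensions add up to `n`. -/
def TightAt {n s : ℕ} (C : Fin s → Finset (Fin n → ℤ))
    (ν : ∀ i : Fin s, {a // a ∈ C i} → ℝ) : Prop :=
  ∀ v : Fin n → ℝ,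
    dimAff (cell (∑ i, convexHull ℝ (castZ '' ↑(C i)))
      (infConv (fun i => convexHull ℝ (castZ '' ↑(C i))) (fun i => lowerEnv (C i) (ν i)))
      v) = n →
    (∑ i, dimAff (comp (fun i => convexHull ℝ (castZ '' ↑(C i)))
      (fun i => lowerEnv (C i) (ν i))
      (cell (∑ i, convexHull ℝ (castZ '' ↑(C i)))
        (infConv (fun i => convexHull ℝ (castZ '' ↑(C i)))
          (fun i => lowerEnv (C i) (ν i))) v) i)) = n

section Barycenter

variable {n : ℕ} {S : Finset (Fin n → ℤ)}

/-- The linear combination of the points of `S` with the given coefficients. -/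
def bary (S : Finset (Fin n → ℤ)) : ({a // a ∈ S} → ℝ) →ₗ[ℝ] (Fin n → ℝ) :=
  Fintype.linearCombination ℝ fun a => castZ (a : Fin n → ℤ)

theorem bary_apply (w : {a // a ∈ S} → ℝ) :
    bary S w = ∑ a, w a • castZ (a : Fin n → ℤ) :=
  Fintype.linearCombination_apply _ _ _

theorem dot_sum {ι : Type*} (s : Finset ι) (v : Fin n → ℝ) (x : ι → Fin n → ℝ) :
    dot v (∑ i ∈ s, x i) = ∑ i ∈ s, dot v (x i) :=
  dotProduct_sum v s x

theorem dot_smul (v x : Fin n → ℝ) (c : ℝ) : dot v (c • x) = c * dot v x := by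
  simp [dot, Finset.mul_sum, mul_left_comm]

theorem dot_bary (v : Fin n → ℝ) (w : {a // a ∈ S} → ℝ) :
    dot v (bary S w) = ∑ a, w a * dot v (castZ (a : Fin n → ℤ)) := by
  simp [bary_apply, dot_sum, dot_smul]

theorem convexHull_range_eq_image {ι E : Type*} [Fintype ι] [AddCommGroup E] [Module ℝ E]
    (f : ι → E) :
    convexHull ℝ (Set.range f) = Fintype.linearCombination ℝ f '' stdSimplex ℝ ι := by
  classical
  rw [← convexHull_basis_eq_stdSimplex, LinearMap.image_convexHull, ← Set.range_comp]
  congr 2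
  ext i
  simp [Fintype.linearCombination_apply]

theorem mem_convexHull_castZ {y : Fin n → ℝ} :
    y ∈ convexHull ℝ (castZ '' (S : Set (Fin n → ℤ))) ↔
      ∃ w ∈ stdSimplex ℝ {a // a ∈ S}, bary S w = y := by
  have h : castZ '' (S : Set (Fin n → ℤ)) =
      Set.range fun a : {a // a ∈ S} => castZ (a : Fin n → ℤ) := by
    ext; simp
  rw [h, convexHull_range_eq_image]
  rfl

theorem mem_convexHull_lift {ν : {a // a ∈ S} → ℝ} {y : Fin n → ℝ} {t : ℝ} :
    (y, t) ∈ convexHull ℝ (Set.range fun a : {a // a ∈ S} =>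
        ((castZ (a : Fin n → ℤ), ν a) : (Fin n → ℝ) × ℝ)) ↔
      ∃ w ∈ stdSimplex ℝ {a // a ∈ S}, bary S w = y ∧ ∑ a, w a * ν a = t := by
  rw [convexHull_range_eq_image]
  simp only [Set.mem_image, Fintype.linearCombination_apply, Prod.ext_iff, Prod.fst_sum,
    Prod.snd_sum, Prod.smul_mk, smul_eq_mul, bary_apply]

theorem continuous_bary : Continuous (bary S) :=
  LinearMap.continuous_of_finiteDimensional _

theorem exists_isLeast_lowerEnv (ν : {a // a ∈ S} → ℝ) {y : Fin n → ℝ}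
    (hy : y ∈ convexHull ℝ (castZ '' (S : Set (Fin n → ℤ)))) :
    ∃ w ∈ stdSimplex ℝ {a // a ∈ S}, bary S w = y ∧ ∑ a, w a * ν a = lowerEnv S ν y ∧
      ∀ w' ∈ stdSimplex ℝ {a // a ∈ S}, bary S w' = y → lowerEnv S ν y ≤ ∑ a, w' a * ν a := by
  have hK : IsCompact (stdSimplex ℝ {a // a ∈ S} ∩ {w | bary S w = y}) :=
    (isCompact_stdSimplex ℝ _).inter_right (isClosed_eq continuous_bary continuous_const)
  obtain ⟨w₀, h₀, h₀'⟩ := mem_convexHull_castZ.1 hy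
  obtain ⟨w, ⟨hw, hwy⟩, hmin⟩ := hK.exists_isMinOn ⟨w₀, h₀, h₀'⟩
    (f := fun w => ∑ a, w a * ν a) (by fun_prop)
  have hle : IsLeast {t | (y, t) ∈ convexHull ℝ (Set.range fun a : {a // a ∈ S} =>
      ((castZ (a : Fin n → ℤ), ν a) : (Fin n → ℝ) × ℝ))} (∑ a, w a * ν a) := by
    refine ⟨mem_convexHull_lift.2 ⟨w, hw, hwy, rfl⟩, ?_⟩
    rintro t ht
    obtain ⟨w', hw', hy', rfl⟩ := mem_convexHull_lift.1 ht
    exact hmin ⟨hw', hy'⟩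
  have heq : lowerEnv S ν y = ∑ a, w a * ν a := hle.csInf_eq
  exact ⟨w, hw, hwy, heq.symm, fun w' hw' hy' => heq ▸ hmin ⟨hw', hy'⟩⟩

theorem lowerEnv_bary_le (ν : {a // a ∈ S} → ℝ) {w : {a // a ∈ S} → ℝ}
    (hw : w ∈ stdSimplex ℝ {a // a ∈ S}) : lowerEnv S ν (bary S w) ≤ ∑ a, w a * ν a := by
  obtain ⟨-, -, -, -, h⟩ := exists_isLeast_lowerEnv ν (mem_convexHull_castZ.2 ⟨w, hw, rfl⟩)
  exact h w hw rfl

theorem sum_mul_sub_eq {v : Fin n → ℝ} {ν w : {a // a ∈ S} → ℝ} {h : ℝ}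
    (hw : w ∈ stdSimplex ℝ {a // a ∈ S}) :
    ∑ a, w a * (dot v (castZ (a : Fin n → ℤ)) + ν a - h) =
      dot v (bary S w) + ∑ a, w a * ν a - h := by
  simp_rw [mul_sub, mul_add, Finset.sum_sub_distrib, Finset.sum_add_distrib, ← dot_bary,
    ← Finset.sum_mul, hw.2, one_mul]

theorem le_dot_add_lowerEnv {v : Fin n → ℝ} {ν : {a // a ∈ S} → ℝ} {h : ℝ}
    (hh : ∀ a : {a // a ∈ S}, h ≤ dot v (castZ (a : Fin n → ℤ)) + ν a) {y : Fin n → ℝ}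
    (hy : y ∈ convexHull ℝ (castZ '' (S : Set (Fin n → ℤ)))) :
    h ≤ dot v y + lowerEnv S ν y := by
  obtain ⟨w, hw, rfl, hwe, -⟩ := exists_isLeast_lowerEnv ν hy
  have := sum_mul_sub_eq (v := v) (ν := ν) (h := h) hw
  have h0 : 0 ≤ ∑ a, w a * (dot v (castZ (a : Fin n → ℤ)) + ν a - h) :=
    Finset.sum_nonneg fun a _ => mul_nonneg (hw.1 a) (sub_nonneg.2 (hh a))
  linarith

theorem exists_bary_of_dot_add_lowerEnv_eq {v : Fin n → ℝ} {ν : {a // a ∈ S} → ℝ} {h : ℝ}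
    (hh : ∀ a : {a // a ∈ S}, h ≤ dot v (castZ (a : Fin n → ℤ)) + ν a) {y : Fin n → ℝ}
    (hy : y ∈ convexHull ℝ (castZ '' (S : Set (Fin n → ℤ))))
    (he : dot v y + lowerEnv S ν y = h) :
    ∃ w ∈ stdSimplex ℝ {a // a ∈ S}, bary S w = y ∧
      ∀ a : {a // a ∈ S}, dot v (castZ (a : Fin n → ℤ)) + ν a ≠ h → w a = 0 := by
  obtain ⟨w, hw, rfl, hwe, -⟩ := exists_isLeast_lowerEnv ν hy
  have hsum : ∑ a, w a * (dot v (castZ (a : Fin n → ℤ)) + ν a - h) = 0 := by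
    rw [sum_mul_sub_eq hw]
    linarith
  rw [Finset.sum_eq_zero_iff_of_nonneg
    fun a _ => mul_nonneg (hw.1 a) (sub_nonneg.2 (hh a))] at hsum
  refine ⟨w, hw, rfl, fun a ha => ?_⟩
  exact (mul_eq_zero.1 (hsum a (Finset.mem_univ a))).resolve_right (sub_ne_zero.2 ha)

end Barycenter

section InfConvolution

variable {n s : ℕ} {C : Fin s → Finset (Fin n → ℤ)} {ν : ∀ i : Fin s, {a // a ∈ C i} → ℝ}

theorem exists_isLeast_infConv (ν : ∀ i : Fin s, {a // a ∈ C i} → ℝ) {y₀ : Fin s → Fin n → ℝ}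
    (hy₀ : ∀ i, y₀ i ∈ convexHull ℝ (castZ '' (C i : Set (Fin n → ℤ)))) :
    ∃ y : Fin s → Fin n → ℝ,
      (∀ i, y i ∈ convexHull ℝ (castZ '' (C i : Set (Fin n → ℤ)))) ∧
      ∑ i, y i = ∑ i, y₀ i ∧
      infConv (fun i => convexHull ℝ (castZ '' ↑(C i))) (fun i => lowerEnv (C i) (ν i))
        (∑ i, y₀ i) = ∑ i, lowerEnv (C i) (ν i) (y i) ∧
      infConv (fun i => convexHull ℝ (castZ '' ↑(C i))) (fun i => lowerEnv (C i) (ν i))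
        (∑ i, y₀ i) ≤ ∑ i, lowerEnv (C i) (ν i) (y₀ i) := by
  have hK : IsCompact ((Set.univ.pi fun i => stdSimplex ℝ {a // a ∈ C i}) ∩
      {w | ∑ i, bary (C i) (w i) = ∑ i, y₀ i}) := by
    refine (isCompact_univ_pi fun i => isCompact_stdSimplex ℝ _).inter_right
      (isClosed_eq ?_ continuous_const)
    exact continuous_finsetSum _ fun i _ => continuous_bary.comp (continuous_apply i)
  choose w₀ h₀ h₀' using fun i => mem_convexHull_castZ.1 (hy₀ i)
  obtain ⟨w, ⟨hw, hwy⟩, hmin⟩ := hK.exists_isMinOn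
    ⟨w₀, fun i _ => h₀ i, by simp [h₀']⟩
    (f := fun w => ∑ i, ∑ a, w i a * ν i a) (by fun_prop)
  have hy : ∀ i, bary (C i) (w i) ∈ convexHull ℝ (castZ '' (C i : Set (Fin n → ℤ))) :=
    fun i => mem_convexHull_castZ.2 ⟨w i, hw i trivial, rfl⟩
  have hle : IsLeast {t | ∃ y : Fin s → Fin n → ℝ,
      (∀ i, y i ∈ convexHull ℝ (castZ '' (C i : Set (Fin n → ℤ)))) ∧
      ∑ i, y i = ∑ i, y₀ i ∧ ∑ i, lowerEnv (C i) (ν i) (y i) = t}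
      (∑ i, lowerEnv (C i) (ν i) (bary (C i) (w i))) := by
    refine ⟨⟨_, hy, hwy, rfl⟩, ?_⟩
    rintro t ⟨y', hy', hsum, rfl⟩
    choose w' hw' hwy' hwe' _ using fun i => exists_isLeast_lowerEnv (ν i) (hy' i)
    calc ∑ i, lowerEnv (C i) (ν i) (bary (C i) (w i))
        ≤ ∑ i, ∑ a, w i a * ν i a :=
          Finset.sum_le_sum fun i _ => lowerEnv_bary_le (ν i) (hw i trivial)
      _ ≤ ∑ i, ∑ a, w' i a * ν i a :=
          hmin (a := w') ⟨fun i _ => hw' i, by simp [hwy', hsum]⟩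
      _ = ∑ i, lowerEnv (C i) (ν i) (y' i) := Finset.sum_congr rfl fun i _ => hwe' i
  have heq : infConv (fun i => convexHull ℝ (castZ '' ↑(C i)))
      (fun i => lowerEnv (C i) (ν i)) (∑ i, y₀ i) =
      ∑ i, lowerEnv (C i) (ν i) (bary (C i) (w i)) := hle.csInf_eq
  exact ⟨_, hy, hwy, heq, heq ▸ hle.2 ⟨y₀, hy₀, rfl, rfl⟩⟩

theorem mem_sum_convexHull {x : Fin n → ℝ}
    (hx : x ∈ ∑ i, convexHull ℝ (castZ '' (C i : Set (Fin n → ℤ)))) :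
    ∃ y : Fin s → Fin n → ℝ,
      (∀ i, y i ∈ convexHull ℝ (castZ '' (C i : Set (Fin n → ℤ)))) ∧ ∑ i, y i = x := by
  obtain ⟨y, hy, rfl⟩ := (Set.mem_finsetSum _ _ _).1 hx
  exact ⟨y, fun i => hy (Finset.mem_univ i), rfl⟩

theorem sum_mem_sum_convexHull {y : Fin s → Fin n → ℝ}
    (hy : ∀ i, y i ∈ convexHull ℝ (castZ '' (C i : Set (Fin n → ℤ)))) :
    ∑ i, y i ∈ ∑ i, convexHull ℝ (castZ '' (C i : Set (Fin n → ℤ))) :=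
  (Set.mem_finsetSum _ _ _).2 ⟨y, fun {i} _ => hy i, rfl⟩

/-- On a cell in direction `v`, the value of the inf-convolution is bounded above by the affine
function determined by the minima `h i` of `⟨v,a⟩ + ν i a`. -/
theorem infConv_add_dot_le_of_mem_cell {v : Fin n → ℝ} {h : Fin s → ℝ}
    (hh : ∀ i (a : {a // a ∈ C i}), h i ≤ dot v (castZ (a : Fin n → ℤ)) + ν i a)
    (hatt : ∀ i, ∃ a : {a // a ∈ C i}, dot v (castZ (a : Fin n → ℤ)) + ν i a = h i)
    {x : Fin n → ℝ}
    (hx : x ∈ cell (∑ i, convexHull ℝ (castZ '' ↑(C i)))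
      (infConv (fun i => convexHull ℝ (castZ '' ↑(C i))) (fun i => lowerEnv (C i) (ν i))) v) :
    dot v x + infConv (fun i => convexHull ℝ (castZ '' ↑(C i)))
      (fun i => lowerEnv (C i) (ν i)) x ≤ ∑ i, h i := by
  classical
  obtain ⟨⟨x, t⟩, ⟨⟨-, hxt⟩, hsupp⟩, rfl⟩ := hx
  simp only at hxt hsupp ⊢
  choose a ha using hatt
  have hbary : ∀ i, bary (C i) (Pi.single (a i) 1) = castZ (a i : Fin n → ℤ) := fun i => by
    simp [bary, Fintype.linearCombination_apply_single]
  have hy : ∀ i, castZ (a i : Fin n → ℤ) ∈ convexHull ℝ (castZ '' (C i : Set (Fin n → ℤ))) :=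
    fun i => subset_convexHull ℝ _ ⟨_, (a i).2, rfl⟩
  obtain ⟨-, -, -, -, hle⟩ := exists_isLeast_infConv ν hy
  have henv : ∀ i, lowerEnv (C i) (ν i) (castZ (a i : Fin n → ℤ)) ≤ ν i (a i) := fun i => by
    have := lowerEnv_bary_le (ν i) (single_mem_stdSimplex ℝ (a i))
    rw [hbary] at this
    simpa [Pi.single_apply] using this
  have hbdd : suppVal (epigraph (∑ i, convexHull ℝ (castZ '' (C i : Set (Fin n → ℤ))))
      (infConv (fun i => convexHull ℝ (castZ '' ↑(C i))) (fun i => lowerEnv (C i) (ν i)))) v ≤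
      dot v (∑ i, castZ (a i : Fin n → ℤ)) + infConv (fun i => convexHull ℝ (castZ '' ↑(C i)))
        (fun i => lowerEnv (C i) (ν i)) (∑ i, castZ (a i : Fin n → ℤ)) := by
    refine csInf_le ⟨∑ i, h i, ?_⟩ ⟨(_, _), ⟨sum_mem_sum_convexHull hy, le_rfl⟩, rfl⟩
    rintro _ ⟨⟨z, r⟩, ⟨hz, hzr⟩, rfl⟩
    obtain ⟨y, hyz, rfl⟩ := mem_sum_convexHull hz
    obtain ⟨y', hy', hsum, heq, -⟩ := exists_isLeast_infConv ν hyz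
    have hge : ∑ i, h i ≤ ∑ i, (dot v (y' i) + lowerEnv (C i) (ν i) (y' i)) :=
      Finset.sum_le_sum fun i _ => le_dot_add_lowerEnv (hh i) (hy' i)
    rw [Finset.sum_add_distrib, ← dot_sum, hsum, ← heq] at hge
    simp only at hzr ⊢
    linarith
  have hsum : ∑ i, (dot v (castZ (a i : Fin n → ℤ)) +
      lowerEnv (C i) (ν i) (castZ (a i : Fin n → ℤ))) ≤ ∑ i, h i :=
    Finset.sum_le_sum fun i _ => by linarith [ha i, henv i]
  rw [Finset.sum_add_distrib, ← dot_sum] at hsum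
  linarith

/-- The points of the components of a cell in direction `v` are barycenters of points `a` at
which `⟨v,a⟩ + ν i a` attains its minimum `h i`. -/
theorem exists_bary_of_mem_comp {v : Fin n → ℝ} {h : Fin s → ℝ}
    (hh : ∀ i (a : {a // a ∈ C i}), h i ≤ dot v (castZ (a : Fin n → ℤ)) + ν i a)
    (hatt : ∀ i, ∃ a : {a // a ∈ C i}, dot v (castZ (a : Fin n → ℤ)) + ν i a = h i)
    {i : Fin s} {z : Fin n → ℝ}
    (hz : z ∈ comp (fun i => convexHull ℝ (castZ '' ↑(C i))) (fun i => lowerEnv (C i) (ν i))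
      (cell (∑ i, convexHull ℝ (castZ '' ↑(C i)))
        (infConv (fun i => convexHull ℝ (castZ '' ↑(C i)))
          (fun i => lowerEnv (C i) (ν i))) v) i) :
    ∃ w ∈ stdSimplex ℝ {a // a ∈ C i}, bary (C i) w = z ∧
      ∀ a : {a // a ∈ C i}, dot v (castZ (a : Fin n → ℤ)) + ν i a ≠ h i → w a = 0 := by
  obtain ⟨y, ⟨hy, hcell, hopt⟩, rfl⟩ := hz
  have hle := infConv_add_dot_le_of_mem_cell hh hatt hcell
  rw [hopt, dot_sum, ← Finset.sum_add_distrib] at hle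
  have hge := fun j => le_dot_add_lowerEnv (hh j) (hy j)
  have heq := (Finset.sum_eq_sum_iff_of_le fun j _ => hge j).1
    (le_antisymm (Finset.sum_le_sum fun j _ => hge j) hle) i (Finset.mem_univ i)
  exact exists_bary_of_dot_add_lowerEnv_eq (hh i) (hy i) heq.symm

/-- Every point of a cell is a sum of points of its components. -/
theorem exists_sum_eq_of_mem_cell {v x : Fin n → ℝ}
    (hx : x ∈ cell (∑ i, convexHull ℝ (castZ '' ↑(C i)))
      (infConv (fun i => convexHull ℝ (castZ '' ↑(C i))) (fun i => lowerEnv (C i) (ν i))) v) :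
    ∃ y : Fin s → Fin n → ℝ, (∀ i, y i ∈
      comp (fun i => convexHull ℝ (castZ '' ↑(C i))) (fun i => lowerEnv (C i) (ν i))
      (cell (∑ i, convexHull ℝ (castZ '' ↑(C i)))
        (infConv (fun i => convexHull ℝ (castZ '' ↑(C i)))
          (fun i => lowerEnv (C i) (ν i))) v) i) ∧ ∑ i, y i = x := by
  have hx' := hx
  obtain ⟨p, ⟨⟨hmem, -⟩, -⟩, rfl⟩ := hx'
  obtain ⟨y₀, hy₀, hsum₀⟩ := mem_sum_convexHull hmem
  rw [← hsum₀] at hx ⊢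
  obtain ⟨y, hy, hsum, heq, -⟩ := exists_isLeast_infConv ν hy₀
  exact ⟨y, fun i => ⟨y, ⟨hy, hsum ▸ hx, hsum ▸ heq⟩, rfl⟩, hsum⟩

end InfConvolution

section Dimension

variable {V : Type*} [AddCommGroup V] [Module ℝ V]

/-- The sum map from a finite product of submodules. -/
def piSum {ι : Type*} [Fintype ι] (L : ι → Submodule ℝ V) : (∀ i, L i) →ₗ[ℝ] V :=
  ∑ i, (L i).subtype ∘ₗ LinearMap.proj i

theorem piSum_apply {ι : Type*} [Fintype ι] (L : ι → Submodule ℝ V) (l : ∀ i, L i) :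
    piSum L l = ∑ i, (l i : V) := by
  simp [piSum]

theorem dimAff_eq (X : Set V) : dimAff X = Module.finrank ℝ (vectorSpan ℝ X) := by
  rw [dimAff, direction_affineSpan]

theorem dimAff_le_sum [FiniteDimensional ℝ V] {ι : Type*} [Fintype ι] {X : Set V} {Y : ι → Set V}
    (h : ∀ x ∈ X, ∃ y : ι → V, (∀ i, y i ∈ Y i) ∧ ∑ i, y i = x) :
    dimAff X ≤ ∑ i, dimAff (Y i) := by
  simp_rw [dimAff_eq]
  rw [← Module.finrank_pi_fintype]
  refine le_trans (Submodule.finrank_mono ?_)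
    (LinearMap.finrank_range_le (piSum fun i => vectorSpan ℝ (Y i)))
  rw [vectorSpan_def, Submodule.span_le]
  rintro _ ⟨x, hx, x', hx', rfl⟩
  obtain ⟨y, hy, rfl⟩ := h x hx
  obtain ⟨y', hy', rfl⟩ := h x' hx'
  refine ⟨fun i => ⟨y i - y' i, vsub_mem_vectorSpan ℝ (hy i) (hy' i)⟩, ?_⟩
  simp [piSum_apply]

theorem sum_dimAff_le [FiniteDimensional ℝ V] {ι : Type*} [Fintype ι] {Y : ι → Set V}
    (L : ι → Submodule ℝ V)
    (hYL : ∀ i, ∀ y ∈ Y i, ∀ y' ∈ Y i, y - y' ∈ L i)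
    (hinj : ∀ l : ι → V, (∀ i, l i ∈ L i) → ∑ i, l i = 0 → ∀ i, l i = 0) :
    ∑ i, dimAff (Y i) ≤ Module.finrank ℝ V := by
  simp_rw [dimAff_eq]
  refine le_trans (Finset.sum_le_sum fun i _ => Submodule.finrank_mono (t := L i) ?_) ?_
  · rw [vectorSpan_def, Submodule.span_le]
    rintro _ ⟨y, hy, y', hy', rfl⟩
    exact hYL i y hy y' hy'
  · rw [← Module.finrank_pi_fintype]
    refine LinearMap.finrank_le_finrank_of_injective (f := piSum L) ?_
    rw [← LinearMap.ker_eq_bot, LinearMap.ker_eq_bot']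
    intro l hl
    rw [piSum_apply] at hl
    ext i
    exact hinj (fun i => l i) (fun i => (l i).2) hl i

end Dimension

/-- Finitely many nonzero additive maps to a field of characteristic zero have a common point at
which none of them vanishes. -/
theorem AddMonoidHom.exists_forall_apply_ne_zero {ι G K : Type*} [AddCommGroup G] [Field K]
    [CharZero K] (t : Finset ι) (g : ι → G →+ K) (hg : ∀ k ∈ t, g k ≠ 0) :
    ∃ w, ∀ k ∈ t, g k w ≠ 0 := by
  classical
  induction t using Finset.induction_on with
  | empty => exact ⟨0, by simp⟩
  | insert m t hm ih =>
    obtain ⟨w, hw⟩ := ih fun k hk => hg k (Finset.mem_insert_of_mem hk)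
    obtain ⟨u, hu⟩ := DFunLike.ne_iff.1 (hg m (Finset.mem_insert_self m t))
    by_cases hmw : g m w = 0
    · have hfin : (⋃ k ∈ t, {r : ℤ | g k u + r * g k w = 0}).Finite := by
        refine t.finite_toSet.biUnion fun k hk => Set.Subsingleton.finite ?_
        intro r hr r' hr'
        have h : (r : K) * g k w = r' * g k w := add_left_cancel (hr.trans hr'.symm)
        exact_mod_cast mul_right_cancel₀ (hw k hk) h
      obtain ⟨r, hr⟩ := hfin.exists_notMem
      simp only [Set.mem_iUnion, exists_prop, not_exists, not_and, Set.mem_ofPred_eq] at hr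
      refine ⟨u + r • w, Finset.forall_mem_insert _ _ _ |>.2 ⟨?_, fun k hk => ?_⟩⟩
      · simpa [hmw] using hu
      · simpa using hr k hk
    · exact ⟨w, Finset.forall_mem_insert _ _ _ |>.2 ⟨hmw, hw⟩⟩

section Hyperplanes

variable {n s : ℕ} {C : Fin s → Finset (Fin n → ℤ)}

/-- The submodule of combinations, with coefficients of sum zero, of the points of `T`. -/
def diffSpan {S : Finset (Fin n → ℤ)} (T : Finset {a // a ∈ S}) : Submodule ℝ (Fin n → ℝ) :=
  Submodule.map (bary S)
    { carrier := {c | (∀ a, a ∉ T → c a = 0) ∧ ∑ a, c a = 0}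
      add_mem' := fun {c d} hc hd =>
        ⟨fun a ha => by simp [hc.1 a ha, hd.1 a ha], by
          simp only [Pi.add_apply, Finset.sum_add_distrib, hc.2, hd.2, add_zero]⟩
      zero_mem' := by simp
      smul_mem' := fun r c hc =>
        ⟨fun a ha => by simp [hc.1 a ha], by
          simp only [Pi.smul_apply, ← Finset.smul_sum, hc.2, smul_zero]⟩ }

theorem mem_diffSpan {S : Finset (Fin n → ℤ)} {T : Finset {a // a ∈ S}} {l : Fin n → ℝ} :
    l ∈ diffSpan T ↔
      ∃ c : {a // a ∈ S} → ℝ, ((∀ a, a ∉ T → c a = 0) ∧ ∑ a, c a = 0) ∧ bary S c = l :=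
  Iff.rfl

/-- The coefficients of a nontrivial relation between the submodules `diffSpan (T i)`. -/
def IsRelation (T : ∀ i, Finset {a // a ∈ C i}) (c : ∀ i, {a // a ∈ C i} → ℝ) : Prop :=
  (∀ i, (∀ a, a ∉ T i → c i a = 0) ∧ ∑ a, c i a = 0) ∧
    ∑ i, bary (C i) (c i) = 0 ∧ ∃ i, bary (C i) (c i) ≠ 0

/-- The linear functional with coefficients `c`. -/
def coeffFunctional (c : ∀ i, {a // a ∈ C i} → ℝ) :
    (∀ i, {a // a ∈ C i} → ℝ) →ₗ[ℝ] ℝ :=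
  ∑ i, Fintype.linearCombination ℝ (c i) ∘ₗ LinearMap.proj i

theorem coeffFunctional_apply (c ν : ∀ i, {a // a ∈ C i} → ℝ) :
    coeffFunctional c ν = ∑ i, ∑ a, ν i a * c i a := by
  simp [coeffFunctional, Fintype.linearCombination_apply]

/-- The point of `AImage C` given by `w`. -/
def pairingHom (C : Fin s → Finset (Fin n → ℤ)) :
    (Fin s → Fin n → ℤ) →+ (∀ i, {a // a ∈ C i} → ℝ) where
  toFun w i a := ∑ j, (w i j : ℝ) * ((a : Fin n → ℤ) j : ℝ)
  map_zero' := by ext; simp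
  map_add' w w' := by ext; simp [add_mul, Finset.sum_add_distrib]

theorem coeffFunctional_pairingHom (c : ∀ i, {a // a ∈ C i} → ℝ) (w : Fin s → Fin n → ℤ) :
    coeffFunctional c (pairingHom C w) = ∑ i, dot (castZ (w i)) (bary (C i) (c i)) := by
  simp only [coeffFunctional_apply, dot_bary, mul_comm]
  rfl

theorem exists_coeffFunctional_pairingHom_ne_zero {T : ∀ i, Finset {a // a ∈ C i}}
    {c : ∀ i, {a // a ∈ C i} → ℝ} (hc : IsRelation T c) :
    ∃ w, coeffFunctional c (pairingHom C w) ≠ 0 := by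
  classical
  obtain ⟨-, -, i, hi⟩ := hc
  obtain ⟨j, hj⟩ := Function.ne_iff.1 hi
  refine ⟨Pi.single i (Pi.single j 1), ?_⟩
  rw [coeffFunctional_pairingHom, Finset.sum_eq_single i]
  · rw [dot, Finset.sum_eq_single j]
    · simpa [castZ] using hj
    · intro k _ hk
      simp [castZ, hk]
    · simp
  · intro k _ hk
    simp [dot, castZ, hk]
  · simp

/-- A relation between minimizing points gives a linear equation satisfied by the weights. -/
theorem coeffFunctional_eq_zero {T : ∀ i, Finset {a // a ∈ C i}}
    {c ν : ∀ i, {a // a ∈ C i} → ℝ} (hc : IsRelation T c) {v : Fin n → ℝ} {h : Fin s → ℝ}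
    (hT : ∀ i, ∀ a ∈ T i, dot v (castZ (a : Fin n → ℤ)) + ν i a = h i) :
    coeffFunctional c ν = 0 := by
  have hterm : ∀ i a, ν i a * c i a = c i a * h i - c i a * dot v (castZ (a : Fin n → ℤ)) := by
    intro i a
    by_cases ha : a ∈ T i
    · rw [← hT i a ha]
      ring
    · simp [(hc.1 i).1 a ha]
  simp_rw [coeffFunctional_apply, hterm, Finset.sum_sub_distrib, ← dot_bary, ← Finset.sum_mul,
    (hc.1 _).2, ← dot_sum, hc.2.1]
  simp [dot]

end Hyperplanes

/-- There is a finite union of hyperplanes `W ⊂ ℝ^𝒞`, not containing the image of the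
linear map `A : N^s → ℝ^𝒞`, such that for every `ν ∉ W` the mixed subdivision `S(Θ_ν)`
is tight. -/
theorem stmt13 {n s : ℕ} (C : Fin s → Finset (Fin n → ℤ)) (hC : ∀ i, (C i).Nonempty) :
    ∃ W : Finset (Set (∀ i : Fin s, {a // a ∈ C i} → ℝ)),
      (∀ H ∈ W, IsHyperplane H) ∧
      ¬ (AImage C ⊆ ⋃ H ∈ W, H) ∧
      (∀ ν, ν ∉ ⋃ H ∈ W, H → TightAt C ν) := by
  classical
  choose! c hc using fun (T : ∀ i, Finset {a // a ∈ C i})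
    (h : ∃ c : ∀ i, {a // a ∈ C i} → ℝ, IsRelation T c) => h
  set R : Finset (∀ i, Finset {a // a ∈ C i}) :=
    Finset.univ.filter fun T => ∃ c : ∀ i, {a // a ∈ C i} → ℝ, IsRelation T c
  have hcR : ∀ T ∈ R, IsRelation T (c T) := fun T hT => hc T (Finset.mem_filter.1 hT).2
  refine ⟨R.image fun T => {ν | coeffFunctional (c T) ν = 0}, ?_, ?_, ?_⟩
  · intro H hH
    obtain ⟨T, hT, rfl⟩ := Finset.mem_image.1 hH
    obtain ⟨w, hw⟩ := exists_coeffFunctional_pairingHom_ne_zero (hcR T hT)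
    exact ⟨coeffFunctional (c T), fun h0 => hw (by simp [h0]), rfl⟩
  · obtain ⟨w, hw⟩ := AddMonoidHom.exists_forall_apply_ne_zero R
      (fun T => (coeffFunctional (c T)).toAddMonoidHom.comp (pairingHom C)) fun T hT h0 => by
        obtain ⟨w, hw⟩ := exists_coeffFunctional_pairingHom_ne_zero (hcR T hT)
        exact hw (DFunLike.congr_fun h0 w)
    intro hsub
    have hmem := hsub (show pairingHom C w ∈ AImage C from ⟨w, fun i a => rfl⟩)
    simp only [Set.mem_iUnion, Finset.mem_image, exists_prop] at hmem
    obtain ⟨_, ⟨T, hT, rfl⟩, h0⟩ := hmem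
    exact hw T hT h0
  · intro ν hν v hdim
    have hmin : ∀ i, ∃ a₀ : {a // a ∈ C i}, ∀ a : {a // a ∈ C i},
        dot v (castZ (a₀ : Fin n → ℤ)) + ν i a₀ ≤ dot v (castZ (a : Fin n → ℤ)) + ν i a := by
      intro i
      have := (hC i).to_subtype
      exact Finite.exists_min fun a : {a // a ∈ C i} => dot v (castZ (a : Fin n → ℤ)) + ν i a
    choose a₀ ha₀ using hmin
    set h : Fin s → ℝ := fun i => dot v (castZ (a₀ i : Fin n → ℤ)) + ν i (a₀ i)
    have hatt : ∀ i, ∃ a : {a // a ∈ C i}, dot v (castZ (a : Fin n → ℤ)) + ν i a = h i :=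
      fun i => ⟨a₀ i, rfl⟩
    refine le_antisymm ?_ (hdim.symm.le.trans
      (dimAff_le_sum fun x hx => exists_sum_eq_of_mem_cell hx))
    set T : ∀ i, Finset {a // a ∈ C i} := fun i =>
      Finset.univ.filter fun a => dot v (castZ (a : Fin n → ℤ)) + ν i a = h i with hT
    refine (sum_dimAff_le (fun i => diffSpan (T i)) ?_ ?_).trans_eq (by simp)
    · intro i y hy y' hy'
      obtain ⟨w, hw, rfl, hw0⟩ := exists_bary_of_mem_comp ha₀ hatt hy
      obtain ⟨w', hw', rfl, hw0'⟩ := exists_bary_of_mem_comp ha₀ hatt hy'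
      refine mem_diffSpan.2 ⟨w - w', ⟨fun a ha => ?_, ?_⟩, map_sub _ _ _⟩
      · have ha' : dot v (castZ (a : Fin n → ℤ)) + ν i a ≠ h i := by simpa [hT] using ha
        simp [hw0 a ha', hw0' a ha']
      · simp only [Pi.sub_apply, Finset.sum_sub_distrib, hw.2, hw'.2, sub_self]
    · intro l hl hsum
      by_contra! hne
      choose d hd hdl using fun i => mem_diffSpan.1 (hl i)
      have hrel : ∃ c : ∀ i, {a // a ∈ C i} → ℝ, IsRelation T c :=
        ⟨d, hd, by simpa [hdl] using hsum, by simpa [hdl] using hne⟩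
      have hTR : T ∈ R := Finset.mem_filter.2 ⟨Finset.mem_univ T, hrel⟩
      refine hν (Set.mem_biUnion (Finset.mem_image_of_mem _ hTR) ?_)
      exact coeffFunctional_eq_zero (hc T hrel) fun i a ha => (Finset.mem_filter.1 ha).2
end
end

section
/- Let ρ_i : Δ_i → ℝ, i = 0,…,n, be convex piecewise affine functions on polytopes in M_ℝ ≅ ℝⁿ that are lattice, i.e. Δ_i = conv(𝒞_i) and ρ_i = ϑ_{ν_i} for finite sets 𝒞_i ⊂ M and integer vectors ν_i ∈ ℤ^{𝒞_i}. Then the mixed integral MI_M(ρ_0, …, ρ_n) is an integer. -/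
open Pointwise MeasureTheory

noncomputable section

section Counting

variable {ι : Type*} {κ : ι → Type*}

/-- A function on `ℕ^ι` agreeing with a polynomial once all arguments are large enough. -/
def EventuallyPoly (g : (ι → ℕ) → ℝ) : Prop :=
  ∃ τ : ℕ, ∃ q : MvPolynomial ι ℝ, ∀ t : ι → ℕ, (∀ i, τ ≤ t i) →
    g t = MvPolynomial.eval (fun i => (t i : ℝ)) q

namespace EventuallyPoly

variable {g h : (ι → ℕ) → ℝ}

theorem add (hg : EventuallyPoly g) (hh : EventuallyPoly h) :
    EventuallyPoly fun t => g t + h t := by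
  obtain ⟨τ, q, hq⟩ := hg
  obtain ⟨τ', q', hq'⟩ := hh
  refine ⟨max τ τ', q + q', fun t ht => ?_⟩
  beta_reduce
  rw [map_add, hq t fun i => (le_max_left _ _).trans (ht i),
    hq' t fun i => (le_max_right _ _).trans (ht i)]

theorem sub (hg : EventuallyPoly g) (hh : EventuallyPoly h) :
    EventuallyPoly fun t => g t - h t := by
  obtain ⟨τ, q, hq⟩ := hg
  obtain ⟨τ', q', hq'⟩ := hh
  refine ⟨max τ τ', q - q', fun t ht => ?_⟩
  beta_reduce
  rw [map_sub, hq t fun i => (le_max_left _ _).trans (ht i),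
    hq' t fun i => (le_max_right _ _).trans (ht i)]

theorem zero : EventuallyPoly fun _ : ι → ℕ => 0 := ⟨0, 0, by simp⟩

theorem sum {β : Type*} (s : Finset β) {g : β → (ι → ℕ) → ℝ}
    (hg : ∀ b, EventuallyPoly (g b)) : EventuallyPoly fun t => ∑ b ∈ s, g b t := by
  classical
  induction s using Finset.induction_on with
  | empty => simpa using zero
  | insert b s hb ih => simpa [Finset.sum_insert hb] using (hg b).add ih

end EventuallyPoly

variable [∀ i, Fintype (κ i)]

/-- The multidegree of an exponent vector whose coordinates are grouped into blocks. -/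
def blockDegree (x : ∀ i, κ i → ℕ) : ι → ℕ := fun i => ∑ a, x i a

theorem blockDegree_add (x y : ∀ i, κ i → ℕ) :
    blockDegree (x + y) = blockDegree x + blockDegree y := by
  ext i
  simp [blockDegree, Finset.sum_add_distrib]

/-- The number of elements of multidegree `t` in a set of exponent vectors. -/
noncomputable def blockCount (U : Set (∀ i, κ i → ℕ)) (t : ι → ℕ) : ℕ :=
  {x | x ∈ U ∧ blockDegree x = t}.ncard

theorem blockCount_Ici (w : ∀ i, κ i → ℕ) (t : ι → ℕ) (ht : blockDegree w ≤ t) :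
    blockCount (Set.Ici w) t =
      blockCount (Set.univ : Set (∀ i, κ i → ℕ)) (t - blockDegree w) := by
  symm
  refine Set.ncard_congr (fun x _ => x + w) ?_ ?_ ?_
  · rintro x ⟨-, hx⟩
    refine ⟨Set.mem_Ici.2 (le_add_of_nonneg_left fun _ _ => Nat.zero_le _), ?_⟩
    rw [blockDegree_add, hx, tsub_add_cancel_of_le ht]
  · intro x y _ _ h
    exact add_right_cancel h
  · rintro x ⟨hx, hx'⟩
    refine ⟨x - w, ⟨trivial, ?_⟩, tsub_add_cancel_of_le hx⟩
    have := blockDegree_add (x - w) w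
    rw [tsub_add_cancel_of_le (show w ≤ x from hx), hx'] at this
    rw [this, add_tsub_cancel_right]

variable [Fintype ι]

theorem finite_blockDegree_eq (t : ι → ℕ) :
    {x : ∀ i, κ i → ℕ | blockDegree x = t}.Finite := by
  refine (Set.Finite.pi' fun i => Set.Finite.pi' fun _ : κ i =>
    Set.finite_Iic (t i)).subset fun x hx i a => ?_
  rw [← (hx : blockDegree x = t)]
  exact Finset.single_le_sum (f := x i) (fun _ _ => Nat.zero_le _) (Finset.mem_univ a)

theorem blockCount_finite (U : Set (∀ i, κ i → ℕ)) (t : ι → ℕ) :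
    {x | x ∈ U ∧ blockDegree x = t}.Finite :=
  (finite_blockDegree_eq t).subset fun _ hx => hx.2

theorem blockCount_union_add_inter (U V : Set (∀ i, κ i → ℕ)) (t : ι → ℕ) :
    blockCount (U ∪ V) t + blockCount (U ∩ V) t = blockCount U t + blockCount V t := by
  rw [blockCount, blockCount, blockCount, blockCount,
    ← Set.ncard_union_add_ncard_inter _ _ (blockCount_finite U t) (blockCount_finite V t)]
  congr 2 <;> ext x <;> simp

theorem blockCount_compl (U : Set (∀ i, κ i → ℕ)) (t : ι → ℕ) :
    blockCount Uᶜ t + blockCount U t = blockCount (Set.univ : Set (∀ i, κ i → ℕ)) t := by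
  have h := blockCount_union_add_inter Uᶜ U t
  rw [Set.compl_union_self, Set.compl_inter_self] at h
  rw [← h]
  simp [blockCount]

theorem card_sum_eq {α : Type*} [Fintype α] [Nonempty α] (m : ℕ) :
    Nat.card {y : α → ℕ // ∑ a, y a = m} =
      (m + (Fintype.card α - 1)).choose (Fintype.card α - 1) := by
  classical
  have e : {y : α → ℕ // ∑ a, y a = m} ≃ Sym α m := (Sym.equivNatSumOfFintype α m).symm
  have hpos : 0 < Fintype.card α := Fintype.card_pos
  rw [Nat.card_congr e, Nat.card_eq_fintype_card, Sym.card_sym_eq_choose,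
    show Fintype.card α + m - 1 = m + (Fintype.card α - 1) by omega, Nat.choose_symm_add]

theorem blockCount_univ [∀ i, Nonempty (κ i)] (t : ι → ℕ) :
    blockCount (Set.univ : Set (∀ i, κ i → ℕ)) t =
      ∏ i, (t i + (Fintype.card (κ i) - 1)).choose (Fintype.card (κ i) - 1) := by
  simp_rw [← card_sum_eq]
  rw [← Nat.card_pi, blockCount, ← Nat.card_coe_set_eq]
  refine Nat.card_congr
    { toFun := fun x i => ⟨x.1 i, congrFun x.2.2 i⟩
      invFun := fun y => ⟨fun i => (y i).1, trivial, funext fun i => (y i).2⟩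
      left_inv := fun _ => rfl
      right_inv := fun _ => rfl }

variable [∀ i, Nonempty (κ i)]

theorem eventuallyPoly_blockCount_Ici (w : ∀ i, κ i → ℕ) :
    EventuallyPoly fun t => (blockCount (Set.Ici w) t : ℝ) := by
  refine ⟨∑ i, blockDegree w i, ∏ i, Polynomial.aeval (MvPolynomial.X i)
    (Polynomial.preHilbertPoly ℝ (Fintype.card (κ i) - 1) (blockDegree w i)), fun t ht => ?_⟩
  have hle : blockDegree w ≤ t := fun i =>
    (Finset.single_le_sum (fun _ _ => Nat.zero_le _) (Finset.mem_univ i)).trans (ht i)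
  beta_reduce
  rw [blockCount_Ici w t hle, blockCount_univ, map_prod, Nat.cast_prod]
  refine Finset.prod_congr rfl fun i _ => ?_
  rw [← MvPolynomial.coe_aeval_eq_eval, RingHom.coe_coe, ← Polynomial.aeval_algHom_apply,
    MvPolynomial.aeval_X, Polynomial.coe_aeval_eq_eval,
    Polynomial.preHilbertPoly_eq_choose_sub_add ℝ _ (hle i)]
  rfl

theorem eventuallyPoly_blockCount_iUnion (s : Finset (∀ i, κ i → ℕ)) :
    EventuallyPoly fun t => (blockCount (⋃ w ∈ s, Set.Ici w) t : ℝ) := by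
  classical
  induction h : s.card using Nat.strong_induction_on generalizing s with
  | _ m ih =>
    obtain rfl | ⟨w, hw⟩ := s.eq_empty_or_nonempty
    · simpa [blockCount] using EventuallyPoly.zero
    have hlt : (s.erase w).card < m := h ▸ Finset.card_erase_lt_of_mem hw
    have h₁ := ih _ hlt (s.erase w) rfl
    have h₂ := ih _ (Finset.card_image_le.trans_lt hlt) ((s.erase w).image (w ⊔ ·)) rfl
    have h₃ := ((eventuallyPoly_blockCount_Ici w).add h₁).sub h₂
    convert h₃ using 2 with t
    have hu : (⋃ v ∈ s, Set.Ici v) = Set.Ici w ∪ ⋃ v ∈ s.erase w, Set.Ici v := by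
      conv_lhs => rw [← Finset.insert_erase hw]
      rw [Finset.set_biUnion_insert]
    have hi : (⋃ v ∈ (s.erase w).image (w ⊔ ·), Set.Ici v) =
        Set.Ici w ∩ ⋃ v ∈ s.erase w, Set.Ici v := by
      rw [Finset.set_biUnion_finset_image, Set.inter_iUnion₂]
      simp_rw [Set.Ici_inter_Ici]
    rw [hu, hi, eq_sub_iff_add_eq]
    exact_mod_cast blockCount_union_add_inter _ _ t

theorem eventuallyPoly_blockCount_of_isUpperSet {U : Set (∀ i, κ i → ℕ)} (hU : IsUpperSet U) :
    EventuallyPoly fun t => (blockCount U t : ℝ) := by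
  have hpwo : U.IsPWO := Set.isPWO_of_wellQuasiOrderedLE U
  have hfin : {x | Minimal (· ∈ U) x}.Finite :=
    WellQuasiOrderedLE.finite_of_isAntichain (setOfPred_minimal_antichain _)
  convert eventuallyPoly_blockCount_iUnion hfin.toFinset using 4
  ext x
  simp only [Set.mem_iUnion, Set.Finite.mem_toFinset, Set.mem_Ici, exists_prop]
  constructor
  · intro hx
    obtain ⟨m, hm, hm'⟩ := exists_minimal_le_of_wellFoundedLT (· ∈ U) x hx
    exact ⟨m, hm', hm⟩
  · rintro ⟨m, hm, hmx⟩
    exact hU hmx hm.prop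

/-- **Khovanskii's theorem**: the number of elements of an iterated sumset, with a finite
number of translates, is eventually polynomial in the multiplicities of the summands. -/
theorem eventuallyPoly_ncard_sumset {G : Type*} [AddCommMonoid G] (B : Finset G)
    (f : (∀ i, κ i → ℕ) →+ G) :
    EventuallyPoly fun t =>
      ({z | ∃ b ∈ B, ∃ x, blockDegree x = t ∧ b + f x = z}.ncard : ℝ) := by
  classical
  obtain ⟨_, _⟩ := exists_wellFoundedLT G
  obtain ⟨_, _⟩ := exists_wellFoundedLT (Σ i, κ i)
  let key : (∀ i, κ i → ℕ) → Lex ((Σ i, κ i) → ℕ) := fun x => toLex fun s => x s.1 s.2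
  have key_add : ∀ x y, key (x + y) = key x + key y := fun _ _ => rfl
  have key_inj : Function.Injective key := fun x y h => by
    ext i a
    exact congrFun (toLex.injective h) ⟨i, a⟩
  let bad : G → Set (∀ i, κ i → ℕ) := fun b => {x | ∃ b' ∈ B, ∃ y,
    blockDegree y = blockDegree x ∧ b' + f y = b + f x ∧
      toLex (key y, b') < toLex (key x, b)}
  have bad_upper : ∀ b, IsUpperSet (bad b) := by
    rintro b x x' hxx' ⟨b', hb', y, hdeg, hf, hlt⟩
    obtain ⟨z, rfl⟩ := exists_add_of_le hxx'
    refine ⟨b', hb', y + z, by rw [blockDegree_add, blockDegree_add, hdeg], ?_, ?_⟩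
    · rw [map_add, map_add, ← add_assoc, hf, add_assoc]
    · rw [Prod.Lex.toLex_lt_toLex] at hlt ⊢
      simp only [key_add] at hlt ⊢
      rcases hlt with h | ⟨h, h'⟩
      · exact Or.inl (add_lt_add_left h _)
      · exact Or.inr ⟨by rw [h], h'⟩
  have hpoly : EventuallyPoly fun t => ∑ b ∈ B, (blockCount (bad b)ᶜ t : ℝ) := by
    refine EventuallyPoly.sum B fun b => ?_
    have huniv : IsUpperSet (Set.univ : Set (∀ i, κ i → ℕ)) := isUpperSet_univ
    convert (eventuallyPoly_blockCount_of_isUpperSet huniv).sub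
      (eventuallyPoly_blockCount_of_isUpperSet (bad_upper b)) using 2 with t
    rw [eq_sub_iff_add_eq]
    exact_mod_cast blockCount_compl (bad b) t
  convert hpoly using 2 with t
  have hfinite : ∀ b, {x | x ∈ (bad b)ᶜ ∧ blockDegree x = t}.Finite :=
    fun b => blockCount_finite _ t
  let T : Finset (Σ _ : G, ∀ i, κ i → ℕ) := B.sigma fun b => (hfinite b).toFinset
  have hT : {z | ∃ b ∈ B, ∃ x, blockDegree x = t ∧ b + f x = z} =
      (fun p : Σ _ : G, ∀ i, κ i → ℕ => p.1 + f p.2) '' (T : Set (Σ _ : G, ∀ i, κ i → ℕ)) := by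
    ext z
    constructor
    · rintro ⟨b, hb, x, hx, rfl⟩
      let S : Finset (G × (∀ i, κ i → ℕ)) :=
        (B ×ˢ (finite_blockDegree_eq t).toFinset).filter fun p => p.1 + f p.2 = b + f x
      have hS : S.Nonempty := ⟨(b, x), by simp [S, hb, hx]⟩
      obtain ⟨⟨c, y⟩, hcy, hmin⟩ := S.exists_min_image (fun p => toLex (key p.2, p.1)) hS
      simp only [S, Finset.mem_filter, Finset.mem_product, Set.Finite.mem_toFinset,
        Set.mem_ofPred_eq] at hcy hmin
      refine ⟨⟨c, y⟩, ?_, hcy.2⟩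
      simp only [T, Finset.coe_sigma, Set.mem_sigma_iff, Finset.mem_coe, Set.Finite.mem_toFinset,
        Set.mem_ofPred_eq, Set.mem_compl_iff]
      refine ⟨hcy.1.1, ?_, hcy.1.2⟩
      rintro ⟨b', hb', y', hdeg, hf, hlt⟩
      exact absurd hlt (not_lt.2 (hmin (b', y')
        ⟨⟨hb', hdeg.trans hcy.1.2⟩, hf.trans hcy.2⟩))
    · rintro ⟨⟨b, x⟩, hp, rfl⟩
      simp only [T, Finset.coe_sigma, Set.mem_sigma_iff, Finset.mem_coe, Set.Finite.mem_toFinset,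
        Set.mem_ofPred_eq] at hp
      exact ⟨b, hp.1, x, hp.2.2, rfl⟩
  have hinj : Set.InjOn (fun p : Σ _ : G, ∀ i, κ i → ℕ => p.1 + f p.2)
      (T : Set (Σ _ : G, ∀ i, κ i → ℕ)) := by
    rintro ⟨b, x⟩ hp ⟨c, y⟩ hq hpq
    simp only [T, Finset.coe_sigma, Set.mem_sigma_iff, Finset.mem_coe, Set.Finite.mem_toFinset,
      Set.mem_ofPred_eq] at hp hq hpq
    rcases lt_trichotomy (toLex (key x, b)) (toLex (key y, c)) with h | h | h
    · exact absurd ⟨b, hp.1, x, hp.2.2.trans hq.2.2.symm, hpq, h⟩ hq.2.1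
    · have h' := Prod.ext_iff.1 (toLex.injective h)
      obtain rfl : b = c := h'.2
      obtain rfl := key_inj h'.1
      rfl
    · exact absurd ⟨c, hq.1, y, hq.2.2.trans hp.2.2.symm, hpq.symm, h⟩ hp.2.1
  rw [hT, hinj.ncard_image, Set.ncard_coe_finset, Finset.card_sigma, Nat.cast_sum]
  refine Finset.sum_congr rfl fun b _ => ?_
  rw [blockCount, Set.ncard_eq_toFinset_card _ (hfinite b)]

end Counting

section MixedDifference

open Filter Topology

theorem Polynomial.natDegree_le_and_coeff_eq_of_tendsto {Q : Polynomial ℝ} {N : ℕ} {v : ℝ}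
    (h : Tendsto (fun m : ℕ => Q.eval (m : ℝ) / (m : ℝ) ^ N) atTop (𝓝 v)) :
    Q.natDegree ≤ N ∧ Q.coeff N = v := by
  have hX : (Polynomial.X ^ N : Polynomial ℝ) ≠ 0 := pow_ne_zero _ Polynomial.X_ne_zero
  have hXdeg : (Polynomial.X ^ N : Polynomial ℝ).degree = N := Polynomial.degree_X_pow N
  have hcast : Tendsto (fun m : ℕ => (m : ℝ)) atTop atTop := tendsto_natCast_atTop_atTop
  rcases lt_trichotomy Q.degree N with hlt | heq | hgt
  · have h' := (Polynomial.div_tendsto_atTop_zero_of_degree_lt Q _ (hXdeg.symm ▸ hlt)).comp hcast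
    simp only [Function.comp_def, Polynomial.eval_pow, Polynomial.eval_X] at h'
    exact ⟨Polynomial.natDegree_le_of_degree_le hlt.le,
      (Polynomial.coeff_eq_zero_of_degree_lt hlt).trans (tendsto_nhds_unique h' h)⟩
  · have h' := (Polynomial.div_tendsto_atTop_leadingCoeff_div_of_degree_eq Q _
      (heq.trans hXdeg.symm)).comp hcast
    simp only [Function.comp_def, Polynomial.eval_pow, Polynomial.eval_X,
      Polynomial.leadingCoeff_X_pow, div_one] at h'
    refine ⟨Polynomial.natDegree_le_of_degree_le heq.le, ?_⟩
    rw [← tendsto_nhds_unique h' h, Polynomial.leadingCoeff,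
      Polynomial.natDegree_eq_of_degree_eq_some heq]
  · have h' := (Polynomial.abs_div_tendsto_atTop_atTop_of_degree_gt Q _
      (hXdeg.symm ▸ hgt) hX).comp hcast
    simp only [Function.comp_def, Polynomial.eval_pow, Polynomial.eval_X] at h'
    exact absurd h.abs (not_tendsto_nhds_of_tendsto_atTop h' _)

variable {ι : Type*} [DecidableEq ι]

/-- The restriction of a polynomial to the line through the origin and an indicator vector. -/
noncomputable def diagonalRestriction (J : Finset ι) (q : MvPolynomial ι ℝ) : Polynomial ℝ :=
  MvPolynomial.aeval (fun i => if i ∈ J then Polynomial.X else 0) q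

theorem eval_diagonalRestriction (J : Finset ι) (q : MvPolynomial ι ℝ) (m : ℝ) :
    (diagonalRestriction J q).eval m =
      MvPolynomial.eval (fun i => if i ∈ J then m else 0) q := by
  rw [diagonalRestriction, ← Polynomial.coe_aeval_eq_eval, MvPolynomial.comp_aeval_apply,
    ← MvPolynomial.coe_aeval_eq_eval]
  exact congrArg (fun g => MvPolynomial.aeval g q) (funext fun i => by split_ifs <;> simp)

variable [Fintype ι]

theorem sum_sign_mul_prod_pow_eq_zero (α : ι → ℕ) (i : ι) (hi : α i = 0) :
    ∑ J ∈ (Finset.univ : Finset ι).powerset, (-1 : ℝ) ^ (Fintype.card ι - J.card) *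
      ∏ j, (if j ∈ J then (1 : ℝ) else 0) ^ α j = 0 := by
  have h := Finset.prod_add (fun _ : ι => (1 : ℝ)) (fun j => -1 * (0 : ℝ) ^ α j) Finset.univ
  rw [Finset.prod_eq_zero (Finset.mem_univ i) (by simp [hi])] at h
  refine Eq.trans ?_ h.symm
  refine Finset.sum_congr rfl fun J _ => ?_
  rw [Finset.prod_const_one, one_mul, Finset.prod_mul_distrib, Finset.prod_const,
    Finset.card_sdiff_of_subset (Finset.subset_univ J), Finset.card_univ,
    ← Finset.prod_sdiff (Finset.subset_univ J)]
  congr 1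
  rw [Finset.prod_congr rfl (g := fun _ => (1 : ℝ)) (s₁ := J) fun j hj => by simp [hj],
    Finset.prod_const_one, mul_one]
  exact Finset.prod_congr rfl fun j hj => by rw [if_neg (Finset.mem_sdiff.1 hj).2]

theorem sum_sign_mul_coeff_diagonalRestriction (q : MvPolynomial ι ℝ) {d : ℕ}
    (hd : d < Fintype.card ι) :
    ∑ J ∈ (Finset.univ : Finset ι).powerset, (-1 : ℝ) ^ (Fintype.card ι - J.card) *
      (diagonalRestriction J q).coeff d = 0 := by
  induction q using MvPolynomial.induction_on' with
  | add p q hp hq =>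
    simp only [diagonalRestriction, map_add, Polynomial.coeff_add, mul_add,
      Finset.sum_add_distrib] at hp hq ⊢
    rw [hp, hq, add_zero]
  | monomial α c =>
    have hcoeff : ∀ J : Finset ι, (diagonalRestriction J (MvPolynomial.monomial α c)).coeff d =
        (if d = ∑ i, α i then c else 0) * ∏ j, (if j ∈ J then (1 : ℝ) else 0) ^ α j := by
      intro J
      have : diagonalRestriction J (MvPolynomial.monomial α c) =
          Polynomial.C (c * ∏ j, (if j ∈ J then (1 : ℝ) else 0) ^ α j) *
            Polynomial.X ^ ∑ i, α i := by
        rw [diagonalRestriction, MvPolynomial.aeval_monomial,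
          Finsupp.prod_fintype _ _ fun _ => pow_zero _, Polynomial.algebraMap_eq, map_mul,
          mul_assoc, map_prod, ← Finset.prod_pow_eq_pow_sum, ← Finset.prod_mul_distrib]
        congr 1
        refine Finset.prod_congr rfl fun j _ => ?_
        rw [map_pow, ← mul_pow]
        split_ifs <;> simp
      rw [this, Polynomial.coeff_C_mul, Polynomial.coeff_X_pow]
      split_ifs <;> ring
    simp_rw [hcoeff]
    by_cases hdα : d = ∑ i, α i
    · obtain ⟨i, hi⟩ : ∃ i, α i = 0 := by
        by_contra! hne
        have : Fintype.card ι ≤ ∑ i, α i := by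
          simpa using Finset.card_nsmul_le_sum Finset.univ (fun i => α i) 1
            fun i _ => Nat.one_le_iff_ne_zero.2 (hne i)
        omega
      rw [if_pos hdα]
      simp_rw [mul_left_comm _ c]
      rw [← Finset.mul_sum, sum_sign_mul_prod_pow_eq_zero _ i hi, mul_zero]
    · simp [hdα]

/-- The mixed difference of the leading form of a polynomial of degree at most `card ι` equals
that of the polynomial itself. -/
theorem sum_sign_mul_limit_eq (q : MvPolynomial ι ℝ) (v : Finset ι → ℝ)
    (h : ∀ J : Finset ι, Tendsto (fun m : ℕ =>
      MvPolynomial.eval (fun i => if i ∈ J then (m : ℝ) else 0) q / (m : ℝ) ^ Fintype.card ι)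
        atTop (𝓝 (v J))) :
    ∑ J ∈ (Finset.univ : Finset ι).powerset, (-1 : ℝ) ^ (Fintype.card ι - J.card) * v J =
      ∑ J ∈ (Finset.univ : Finset ι).powerset, (-1 : ℝ) ^ (Fintype.card ι - J.card) *
        MvPolynomial.eval (fun i => if i ∈ J then 1 else 0) q := by
  have key : ∀ J, MvPolynomial.eval (fun i => if i ∈ J then 1 else 0) q =
      ∑ d ∈ Finset.range (Fintype.card ι), (diagonalRestriction J q).coeff d + v J := by
    intro J
    simp_rw [← eval_diagonalRestriction] at h ⊢
    obtain ⟨hdeg, hco⟩ := Polynomial.natDegree_le_and_coeff_eq_of_tendsto (h J)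
    rw [Polynomial.eval_eq_sum_range' (Nat.lt_succ_of_le hdeg), Finset.sum_range_succ, hco]
    simp
  simp_rw [key, mul_add, Finset.sum_add_distrib, Finset.mul_sum]
  rw [Finset.sum_comm, Finset.sum_eq_zero (s := Finset.range _), zero_add]
  exact fun d hd => sum_sign_mul_coeff_diagonalRestriction q (Finset.mem_range.1 hd)

end MixedDifference

section LatticeVolume

open Filter Topology

/-- The embedding `ℤⁿ × ℤ → ℝⁿ × ℝ`. -/
def latticeEmb (n : ℕ) : (Fin n → ℤ) × ℤ →+ (Fin n → ℝ) × ℝ where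
  toFun z := (fun j => (z.1 j : ℝ), (z.2 : ℝ))
  map_zero' := by ext <;> simp
  map_add' z w := by ext <;> simp

/-- The coordinatewise floor `ℝⁿ × ℝ → ℤⁿ × ℤ`. -/
noncomputable def latticeFloor {n : ℕ} (e : (Fin n → ℝ) × ℝ) : (Fin n → ℤ) × ℤ :=
  (fun j => ⌊e.1 j⌋, ⌊e.2⌋)

variable {n : ℕ}

theorem latticeFloor_sub_latticeEmb (e : (Fin n → ℝ) × ℝ) (z : (Fin n → ℤ) × ℤ) :
    latticeFloor (e - latticeEmb n z) = latticeFloor e - z := by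
  ext <;> simp [latticeFloor, latticeEmb]

theorem dist_latticeEmb_latticeFloor_le (e : (Fin n → ℝ) × ℝ) :
    dist e (latticeEmb n (latticeFloor e)) ≤ 1 := by
  have h : ∀ r : ℝ, dist r (⌊r⌋ : ℝ) ≤ 1 := fun r => by
    rw [Real.dist_eq, abs_of_nonneg (by linarith [Int.floor_le r])]
    linarith [Int.lt_floor_add_one r]
  rw [Prod.dist_eq]
  exact max_le ((dist_pi_le_iff zero_le_one).2 fun j => h _) (h _)

theorem measurable_latticeFloor : Measurable (latticeFloor (n := n)) := by
  unfold latticeFloor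
  fun_prop

theorem exists_finset_latticeFloor_mem (R : ℝ) :
    ∃ B : Finset ((Fin n → ℤ) × ℤ), ∀ e : (Fin n → ℝ) × ℝ, ‖e‖ ≤ R → latticeFloor e ∈ B := by
  refine ⟨Finset.Icc (fun _ => -⌈R⌉) (fun _ => ⌈R⌉) ×ˢ Finset.Icc (-⌈R⌉) ⌈R⌉, fun e he => ?_⟩
  have h : ∀ r : ℝ, ‖r‖ ≤ R → -⌈R⌉ ≤ ⌊r⌋ ∧ ⌊r⌋ ≤ ⌈R⌉ := fun r hr => by
    have hr' := abs_le.1 (hr.trans (Int.le_ceil R))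
    constructor
    · exact Int.le_floor.2 (by exact_mod_cast hr'.1)
    · exact_mod_cast (Int.floor_le r).trans hr'.2
  have h₁ : ∀ j, ‖e.1 j‖ ≤ R := fun j => ((norm_le_pi_norm e.1 j).trans (norm_fst_le e)).trans he
  have h₂ : ‖e.2‖ ≤ R := (norm_snd_le e).trans he
  exact Finset.mem_product.2 ⟨Finset.mem_Icc.2 ⟨fun j => (h _ (h₁ j)).1,
    fun j => (h _ (h₁ j)).2⟩, Finset.mem_Icc.2 (h _ h₂)⟩

theorem volume_latticeFloor_preimage_singleton (z : (Fin n → ℤ) × ℤ) :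
    volume (latticeFloor ⁻¹' {z}) = 1 := by
  have : latticeFloor ⁻¹' {z} =
      (Set.univ.pi fun j => Set.Ico (z.1 j : ℝ) (z.1 j + 1)) ×ˢ Set.Ico (z.2 : ℝ) (z.2 + 1) := by
    ext e
    simp [latticeFloor, Prod.ext_iff, funext_iff, Int.floor_eq_iff]
  rw [this, Measure.volume_eq_prod, Measure.prod_prod, volume_pi_pi]
  simp

theorem volume_latticeFloor_preimage {X : Set ((Fin n → ℤ) × ℤ)} (hX : X.Finite) :
    volume (latticeFloor ⁻¹' X) = X.ncard := by
  rw [← hX.coe_toFinset, ← sum_measure_preimage_singleton _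
    fun z _ => measurable_latticeFloor (measurableSet_singleton z)]
  rw [Set.ncard_coe_finset]
  simp [volume_latticeFloor_preimage_singleton]

variable {ι : Type*} [Fintype ι] {κ : ι → Type*} [∀ i, Fintype (κ i)]

/-- The linear combination of lattice points with given real coefficients. -/
noncomputable def realCombination (f : ∀ i, κ i → (Fin n → ℤ) × ℤ) :
    (∀ i, κ i → ℝ) →L[ℝ] (Fin n → ℝ) × ℝ :=
  ∑ i, ∑ a, ((ContinuousLinearMap.proj a).comp
    (ContinuousLinearMap.proj (R := ℝ) (φ := fun i => κ i → ℝ) i)).smulRight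
      (latticeEmb n (f i a))

theorem realCombination_apply (f : ∀ i, κ i → (Fin n → ℤ) × ℤ) (x : ∀ i, κ i → ℝ) :
    realCombination f x = ∑ i, ∑ a, x i a • latticeEmb n (f i a) := by
  simp [realCombination]

/-- The combination of lattice points with given natural number coefficients. -/
def natCombination (f : ∀ i, κ i → (Fin n → ℤ) × ℤ) : (∀ i, κ i → ℕ) →+ (Fin n → ℤ) × ℤ where
  toFun x := ∑ i, ∑ a, x i a • f i a
  map_zero' := by simp
  map_add' x y := by simp [add_smul, Finset.sum_add_distrib]

theorem latticeEmb_natCombination (f : ∀ i, κ i → (Fin n → ℤ) × ℤ) (x : ∀ i, κ i → ℕ) :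
    latticeEmb n (natCombination f x) = realCombination f fun i a => (x i a : ℝ) := by
  simp only [natCombination, realCombination_apply, map_sum, Nat.cast_smul_eq_nsmul, map_nsmul,
    AddMonoidHom.coe_mk, ZeroHom.coe_mk]

/-- The nonnegative real coefficient families with block sums `t`. -/
def coefficientPolytope (κ : ι → Type*) [∀ i, Fintype (κ i)] (t : ι → ℝ) :
    Set (∀ i, κ i → ℝ) :=
  {x | (∀ i a, 0 ≤ x i a) ∧ ∀ i, ∑ a, x i a = t i}

/-- The Minkowski combination, with weights `t`, of the convex hulls of the blocks of `f`. -/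
def minkowskiCombination (f : ∀ i, κ i → (Fin n → ℤ) × ℤ) (t : ι → ℝ) :
    Set ((Fin n → ℝ) × ℝ) :=
  realCombination f '' coefficientPolytope κ t

theorem isCompact_minkowskiCombination (f : ∀ i, κ i → (Fin n → ℤ) × ℤ) (t : ι → ℝ) :
    IsCompact (minkowskiCombination f t) := by
  refine IsCompact.image ?_ (realCombination f).continuous
  refine Metric.isCompact_of_isClosed_isBounded ?_ ?_
  · have : coefficientPolytope κ t =
        (⋂ i, ⋂ a, {x | 0 ≤ x i a}) ∩ ⋂ i, {x | ∑ a, x i a = t i} := by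
      ext x
      simp [coefficientPolytope]
    rw [this]
    refine (isClosed_iInter fun i => isClosed_iInter fun a => ?_).inter
      (isClosed_iInter fun i => ?_)
    · exact isClosed_le (by fun_prop) (by fun_prop)
    · exact isClosed_eq (by fun_prop) (by fun_prop)
  · refine (Metric.isBounded_Icc (0 : ∀ i, κ i → ℝ) fun i _ => t i).subset fun x hx => ?_
    refine ⟨fun i a => hx.1 i a, fun i a => ?_⟩
    beta_reduce
    rw [← hx.2 i]
    exact Finset.single_le_sum (f := x i) (fun a _ => hx.1 i a) (Finset.mem_univ a)

theorem smul_minkowskiCombination_subset (f : ∀ i, κ i → (Fin n → ℤ) × ℤ) (t : ι → ℝ) {r : ℝ}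
    (hr : 0 ≤ r) : r • minkowskiCombination f t ⊆ minkowskiCombination f (r • t) := by
  rintro _ ⟨_, ⟨x, hx, rfl⟩, rfl⟩
  refine ⟨r • x, ⟨fun i a => mul_nonneg hr (hx.1 i a), fun i => ?_⟩, map_smul _ _ _⟩
  simp [← hx.2 i, Finset.mul_sum]

theorem add_mem_minkowskiCombination (f : ∀ i, κ i → (Fin n → ℤ) × ℤ) {s t : ι → ℝ}
    {p q : (Fin n → ℝ) × ℝ} (hp : p ∈ minkowskiCombination f s)
    (hq : q ∈ minkowskiCombination f t) : p + q ∈ minkowskiCombination f (s + t) := by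
  obtain ⟨x, hx, rfl⟩ := hp
  obtain ⟨y, hy, rfl⟩ := hq
  refine ⟨x + y, ⟨fun i a => add_nonneg (hx.1 i a) (hy.1 i a), fun i => ?_⟩, map_add _ _ _⟩
  simp [← hx.2 i, ← hy.2 i, Finset.sum_add_distrib]

theorem minkowskiCombination_nonempty [∀ i, Nonempty (κ i)] (f : ∀ i, κ i → (Fin n → ℤ) × ℤ)
    {t : ι → ℝ} (ht : 0 ≤ t) : (minkowskiCombination f t).Nonempty := by
  classical
  refine ⟨_, fun i => Pi.single (Classical.arbitrary (κ i)) (t i), ⟨fun i a => ?_, fun i => ?_⟩,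
    rfl⟩
  · beta_reduce
    rw [Pi.single_apply]
    split_ifs
    exacts [ht i, le_rfl]
  · simp

/-- The integer points obtained from a finite set of translations and an iterated sumset. -/
def sumsetPoints (B : Finset ((Fin n → ℤ) × ℤ)) (f : ∀ i, κ i → (Fin n → ℤ) × ℤ) (t : ι → ℕ) :
    Set ((Fin n → ℤ) × ℤ) :=
  {z | ∃ b ∈ B, ∃ x, blockDegree x = t ∧ b + natCombination f x = z}

theorem finite_sumsetPoints (B : Finset ((Fin n → ℤ) × ℤ)) (f : ∀ i, κ i → (Fin n → ℤ) × ℤ)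
    (t : ι → ℕ) : (sumsetPoints B f t).Finite := by
  refine ((B.finite_toSet.prod (finite_blockDegree_eq t)).image
    fun p => p.1 + natCombination f p.2).subset ?_
  rintro _ ⟨b, hb, x, hx, rfl⟩
  exact ⟨(b, x), ⟨hb, hx⟩, rfl⟩

theorem exists_finset_latticeFloor_mem_sumsetPoints [∀ i, Nonempty (κ i)]
    (f : ∀ i, κ i → (Fin n → ℤ) × ℤ) :
    ∃ B : Finset ((Fin n → ℤ) × ℤ), ∀ (t : ι → ℕ) (e : (Fin n → ℝ) × ℝ),
      e ∈ minkowskiCombination f (fun i => (t i : ℝ)) → latticeFloor e ∈ sumsetPoints B f t := by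
  classical
  obtain ⟨B, hB⟩ := exists_finset_latticeFloor_mem (n := n)
    (‖realCombination f‖ * (1 + ∑ i, (Fintype.card (κ i) : ℝ)))
  refine ⟨B, ?_⟩
  rintro t _ ⟨x, hx, rfl⟩
  have hfl : ∀ i a, (⌊x i a⌋₊ : ℝ) ≤ x i a := fun i a => Nat.floor_le (hx.1 i a)
  have hfl' : ∀ i a, x i a < ⌊x i a⌋₊ + 1 := fun i a => Nat.lt_floor_add_one _
  have hxt : ∀ i, ∑ a, x i a = t i := hx.2
  have hsum : ∀ i, ∑ a, ⌊x i a⌋₊ ≤ t i := fun i => by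
    have := Finset.sum_le_sum fun a (_ : a ∈ Finset.univ) => hfl i a
    rw [hxt i] at this
    exact_mod_cast this
  have hsum' : ∀ i, t i ≤ ∑ a, ⌊x i a⌋₊ + Fintype.card (κ i) := fun i => by
    have := Finset.sum_le_sum fun a (_ : a ∈ Finset.univ) => (hfl' i a).le
    rw [hxt i, Finset.sum_add_distrib] at this
    simp only [Finset.sum_const, Finset.card_univ, nsmul_eq_mul, mul_one] at this
    exact_mod_cast this
  let y : ∀ i, κ i → ℕ := fun i a => ⌊x i a⌋₊ +
    (Pi.single (Classical.arbitrary (κ i)) (t i - ∑ a, ⌊x i a⌋₊) : κ i → ℕ) a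
  have hy : blockDegree y = t := by
    ext i
    simp only [blockDegree, y, Finset.sum_add_distrib]
    simp [hsum i]
  have hnorm : ‖x - fun i a => (y i a : ℝ)‖ ≤ 1 + ∑ i, (Fintype.card (κ i) : ℝ) := by
    have hpos : (0 : ℝ) ≤ 1 + ∑ i, (Fintype.card (κ i) : ℝ) := by positivity
    refine (pi_norm_le_iff_of_nonneg hpos).2 fun i => (pi_norm_le_iff_of_nonneg hpos).2 fun a => ?_
    have hcard : (Fintype.card (κ i) : ℝ) ≤ ∑ i, (Fintype.card (κ i) : ℝ) :=
      Finset.single_le_sum (f := fun i => (Fintype.card (κ i) : ℝ))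
        (fun _ _ => Nat.cast_nonneg _) (Finset.mem_univ i)
    have hs : ((Pi.single (Classical.arbitrary (κ i)) (t i - ∑ a, ⌊x i a⌋₊) : κ i → ℕ) a : ℝ) ≤
        Fintype.card (κ i) := by
      rw [Pi.single_apply]
      split_ifs
      · exact_mod_cast tsub_le_iff_left.2 (hsum' i)
      · simp
    have hs0 : (0 : ℝ) ≤
        ((Pi.single (Classical.arbitrary (κ i)) (t i - ∑ a, ⌊x i a⌋₊) : κ i → ℕ) a : ℝ) :=
      Nat.cast_nonneg _
    simp only [y, Pi.sub_apply, Nat.cast_add, Real.norm_eq_abs, abs_le]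
    constructor <;> linarith [hfl i a, hfl' i a]
  refine ⟨_, hB (realCombination f (x - fun i a => (y i a : ℝ))) ?_, y, hy, ?_⟩
  · exact ((realCombination f).le_opNorm _).trans
      (mul_le_mul_of_nonneg_left hnorm (norm_nonneg _))
  · rw [map_sub, ← latticeEmb_natCombination, latticeFloor_sub_latticeEmb, sub_add_cancel]

theorem exists_dist_le_of_latticeFloor_mem_sumsetPoints (B : Finset ((Fin n → ℤ) × ℤ))
    (f : ∀ i, κ i → (Fin n → ℤ) × ℤ) (τ : ℕ) :
    ∃ R : ℝ, 0 ≤ R ∧ ∀ (t : ι → ℕ) (e : (Fin n → ℝ) × ℝ),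
      latticeFloor e ∈ sumsetPoints B f (fun i => t i + τ) →
        ∃ p ∈ minkowskiCombination f (fun i => (t i : ℝ)), dist e p ≤ R := by
  refine ⟨1 + ∑ b ∈ B, ‖latticeEmb n b‖ + ‖realCombination f‖ * τ, by positivity, ?_⟩
  rintro t e ⟨b, hb, x, hx, hz⟩
  have hx' : ∀ i, ∑ a, (x i a : ℝ) = t i + τ := fun i => by
    exact_mod_cast congrFun hx i
  let y : ∀ i, κ i → ℝ := fun i a => x i a * (t i / (t i + τ))
  refine ⟨realCombination f y, ⟨y, ⟨fun i a => by positivity, fun i => ?_⟩, rfl⟩, ?_⟩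
  · rw [← Finset.sum_mul, hx']
    rcases (by positivity : (0 : ℝ) ≤ t i + τ).eq_or_lt with h | h
    · have h0 : (t i : ℝ) = 0 :=
        le_antisymm (by linarith [(Nat.cast_nonneg τ : (0 : ℝ) ≤ τ)]) (Nat.cast_nonneg _)
      simp [h0]
    · field_simp
  have hnorm : ‖(fun i a => (x i a : ℝ)) - y‖ ≤ τ := by
    have hpos : (0 : ℝ) ≤ τ := Nat.cast_nonneg _
    refine (pi_norm_le_iff_of_nonneg hpos).2 fun i => (pi_norm_le_iff_of_nonneg hpos).2 fun a => ?_
    have hxle : (x i a : ℝ) ≤ t i + τ := by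
      rw [← hx' i]
      exact Finset.single_le_sum (f := fun a => (x i a : ℝ)) (fun _ _ => Nat.cast_nonneg _)
        (Finset.mem_univ a)
    rcases (by positivity : (0 : ℝ) ≤ t i + τ).eq_or_lt with h | h
    · have h0 : (x i a : ℝ) = 0 := le_antisymm (hxle.trans h.symm.le) (Nat.cast_nonneg _)
      simp [y, h0]
    · have : (x i a : ℝ) - x i a * (t i / (t i + τ)) = x i a / (t i + τ) * τ := by
        field_simp
        ring
      simp only [y, Pi.sub_apply]
      rw [this, Real.norm_of_nonneg (by positivity)]
      exact mul_le_of_le_one_left hpos ((div_le_one h).2 hxle)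
  have h₁ := dist_latticeEmb_latticeFloor_le e
  rw [← hz, map_add, latticeEmb_natCombination] at h₁
  have h₂ : ‖latticeEmb n b‖ ≤ ∑ b ∈ B, ‖latticeEmb n b‖ :=
    Finset.single_le_sum (f := fun b => ‖latticeEmb n b‖) (fun _ _ => norm_nonneg _) hb
  have h₃ : ‖realCombination f ((fun i a => (x i a : ℝ)) - y)‖ ≤ ‖realCombination f‖ * τ :=
    ((realCombination f).le_opNorm _).trans (mul_le_mul_of_nonneg_left hnorm (norm_nonneg _))
  rw [map_sub] at h₃
  rw [dist_eq_norm] at h₁ ⊢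
  have : e - realCombination f y =
      (e - (latticeEmb n b + realCombination f fun i a => (x i a : ℝ))) + latticeEmb n b +
        ((realCombination f fun i a => (x i a : ℝ)) - realCombination f y) := by abel
  rw [this]
  exact norm_add₃_le.trans (by linarith)

instance isAddHaarMeasure_volume_prod :
    (volume : Measure ((Fin n → ℝ) × ℝ)).IsAddHaarMeasure :=
  Measure.prod.instIsAddHaarMeasure _ _

theorem volume_smul_prod (r : ℝ) (hr : 0 ≤ r) (s : Set ((Fin n → ℝ) × ℝ)) :
    volume (r • s) = ENNReal.ofReal (r ^ (n + 1)) * volume s := by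
  rw [Measure.addHaar_smul]
  simp [abs_of_nonneg hr]

/-- The volume of a Minkowski combination is the leading asymptotic of the number of points
of the corresponding sumsets. -/
theorem tendsto_ncard_sumsetPoints [∀ i, Nonempty (κ i)] (f : ∀ i, κ i → (Fin n → ℤ) × ℤ)
    {B : Finset ((Fin n → ℤ) × ℤ)}
    (hB : ∀ (t : ι → ℕ) (e : (Fin n → ℝ) × ℝ),
      e ∈ minkowskiCombination f (fun i => (t i : ℝ)) → latticeFloor e ∈ sumsetPoints B f t)
    (τ : ℕ) (t : ι → ℕ) :
    Tendsto (fun m : ℕ => ((sumsetPoints B f fun i => m * t i + τ).ncard : ℝ) /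
      (m : ℝ) ^ (n + 1)) atTop
        (𝓝 (volume (minkowskiCombination f fun i => (t i : ℝ))).toReal) := by
  obtain ⟨R, hR, hRdist⟩ := exists_dist_le_of_latticeFloor_mem_sumsetPoints B f τ
  set K := minkowskiCombination f fun i => (t i : ℝ) with hK
  have hKc : IsCompact K := isCompact_minkowskiCombination f _
  have hcast : ∀ m : ℕ, (fun i => ((m * t i : ℕ) : ℝ)) = (m : ℝ) • fun i => (t i : ℝ) :=
    fun m => by ext; simp
  have hvol : ∀ m : ℕ, volume (latticeFloor ⁻¹' sumsetPoints B f fun i => m * t i + τ) =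
      (sumsetPoints B f fun i => m * t i + τ).ncard :=
    fun m => volume_latticeFloor_preimage (finite_sumsetPoints _ _ _)
  have lower : ∀ m : ℕ, ENNReal.ofReal ((m : ℝ) ^ (n + 1)) * volume K ≤
      (sumsetPoints B f fun i => m * t i + τ).ncard := by
    intro m
    obtain ⟨v, hv⟩ := minkowskiCombination_nonempty f (t := fun _ : ι => (τ : ℝ))
      fun _ => Nat.cast_nonneg _
    rw [← volume_smul_prod _ (Nat.cast_nonneg m), ← hvol,
      ← measure_preimage_add_right volume (-v)]
    refine measure_mono fun e he => hB _ _ ?_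
    convert add_mem_minkowskiCombination f
      (smul_minkowskiCombination_subset f _ (Nat.cast_nonneg m) he) hv using 2
    · ext i
      simp
    · simp
  have upper : ∀ m : ℕ, 0 < m → ((sumsetPoints B f fun i => m * t i + τ).ncard : ENNReal) ≤
      ENNReal.ofReal ((m : ℝ) ^ (n + 1)) * volume (Metric.cthickening (R / m) K) := by
    intro m hm
    have hm' : (0 : ℝ) < m := Nat.cast_pos.2 hm
    rw [← volume_smul_prod _ hm'.le, ← hvol]
    refine measure_mono fun e he => ?_
    obtain ⟨p, hp, hd⟩ := hRdist (fun i => m * t i) e he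
    rw [Set.mem_smul_set_iff_inv_smul_mem₀ hm'.ne']
    refine Metric.mem_cthickening_of_dist_le _ ((m : ℝ)⁻¹ • p) _ _ ?_ ?_
    · rw [hcast] at hp
      convert smul_minkowskiCombination_subset f _ (inv_nonneg.2 hm'.le)
        (Set.smul_mem_smul_set hp) using 1
      rw [inv_smul_smul₀ hm'.ne']
    · rw [dist_smul₀, Real.norm_of_nonneg (inv_nonneg.2 hm'.le), div_eq_inv_mul]
      exact mul_le_mul_of_nonneg_left hd (inv_nonneg.2 hm'.le)
  have hfin : ∀ r : ℝ, volume (Metric.cthickening r K) ≠ ⊤ := fun r =>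
    (hKc.isBounded.cthickening (δ := r)).measure_lt_top.ne
  have hlim : Tendsto (fun m : ℕ => (volume (Metric.cthickening (R / m) K)).toReal) atTop
      (𝓝 (volume K).toReal) :=
    (ENNReal.tendsto_toReal hKc.measure_ne_top).comp
      ((tendsto_measure_cthickening_of_isCompact hKc).comp
        (tendsto_const_div_atTop_nhds_zero_nat R))
  refine tendsto_of_tendsto_of_tendsto_of_le_of_le' tendsto_const_nhds hlim ?_ ?_
  · filter_upwards [eventually_gt_atTop 0] with m hm
    have hm' : (0 : ℝ) < (m : ℝ) ^ (n + 1) := pow_pos (Nat.cast_pos.2 hm) _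
    have := ENNReal.toReal_mono (ENNReal.natCast_ne_top _) (lower m)
    rw [ENNReal.toReal_mul, ENNReal.toReal_ofReal hm'.le, ENNReal.toReal_natCast] at this
    rwa [le_div_iff₀' hm']
  · filter_upwards [eventually_gt_atTop 0] with m hm
    have hm' : (0 : ℝ) < (m : ℝ) ^ (n + 1) := pow_pos (Nat.cast_pos.2 hm) _
    have := ENNReal.toReal_mono (ENNReal.mul_ne_top ENNReal.ofReal_ne_top (hfin _)) (upper m hm)
    rw [ENNReal.toReal_mul, ENNReal.toReal_ofReal hm'.le, ENNReal.toReal_natCast] at this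
    rwa [div_le_iff₀' hm']

/-- **Integrality of mixed volumes** of lattice polytopes. -/
theorem exists_int_sum_sign_volume [∀ i, Nonempty (κ i)] [DecidableEq ι]
    (hι : Fintype.card ι = n + 1) (f : ∀ i, κ i → (Fin n → ℤ) × ℤ) :
    ∃ k : ℤ, ∑ J ∈ (Finset.univ : Finset ι).powerset, (-1 : ℝ) ^ (n + 1 - J.card) *
      (volume (minkowskiCombination f fun i => if i ∈ J then 1 else 0)).toReal = k := by
  obtain ⟨B, hB⟩ := exists_finset_latticeFloor_mem_sumsetPoints f
  obtain ⟨τ, q, hq⟩ := eventuallyPoly_ncard_sumset B (natCombination f)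
  let q' : MvPolynomial ι ℝ :=
    MvPolynomial.bind₁ (fun i => MvPolynomial.X i + MvPolynomial.C (τ : ℝ)) q
  have hq' : ∀ t : ι → ℕ, MvPolynomial.eval (fun i => (t i : ℝ)) q' =
      (sumsetPoints B f fun i => t i + τ).ncard := by
    intro t
    refine Eq.trans ?_ (hq (fun i => t i + τ) fun i => Nat.le_add_left _ _).symm
    rw [← MvPolynomial.coe_aeval_eq_eval, RingHom.coe_coe, MvPolynomial.aeval_bind₁,
      ← MvPolynomial.coe_aeval_eq_eval]
    refine congrArg (fun g => MvPolynomial.aeval g q) (funext fun i => ?_)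
    simp
  have h := sum_sign_mul_limit_eq q'
    (fun J => (volume (minkowskiCombination f fun i => if i ∈ J then 1 else 0)).toReal) ?_
  · rw [hι] at h
    rw [h]
    refine ⟨∑ J ∈ (Finset.univ : Finset ι).powerset, (-1 : ℤ) ^ (n + 1 - J.card) *
      (sumsetPoints B f fun i => (if i ∈ J then 1 else 0) + τ).ncard, ?_⟩
    push_cast
    refine Finset.sum_congr rfl fun J _ => ?_
    rw [← hq']
    simp
  · intro J
    have := tendsto_ncard_sumsetPoints f hB τ fun i => if i ∈ J then 1 else 0
    rw [hι]
    convert this using 2 with m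
    · rw [← hq']
      simp
    · simp

end LatticeVolume

section TruncatedEpigraph

variable {n : ℕ}

theorem mem_convexHull_range_iff_exists_weights {α E : Type*} [Fintype α] [AddCommGroup E]
    [Module ℝ E] (g : α → E) (x : E) :
    x ∈ convexHull ℝ (Set.range g) ↔
      ∃ w : α → ℝ, (∀ a, 0 ≤ w a) ∧ ∑ a, w a = 1 ∧ ∑ a, w a • g a = x := by
  classical
  constructor
  · intro hx
    have : Set.range g = (Fintype.linearCombination ℝ g) ''
        Set.range (fun a : α => (Pi.single a 1 : α → ℝ)) := by
      rw [← Set.range_comp]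
      congr 1
      ext a
      simp
    rw [this, ← LinearMap.image_convexHull, convexHull_rangle_single_eq_stdSimplex] at hx
    obtain ⟨w, hw, rfl⟩ := hx
    exact ⟨w, hw.1, hw.2, rfl⟩
  · rintro ⟨w, hw, hw1, rfl⟩
    exact (convex_convexHull ℝ _).sum_mem (fun a _ => hw a) hw1
      fun a _ => subset_convexHull ℝ _ ⟨a, rfl⟩

/-- The convex hull of the graph of a lifting of lattice points. -/
def liftedHull (S : Finset (Fin n → ℤ)) (ν : {a // a ∈ S} → ℝ) : Set ((Fin n → ℝ) × ℝ) :=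
  convexHull ℝ (Set.range fun a : {a // a ∈ S} => (castZ (a : Fin n → ℤ), ν a))

variable {S : Finset (Fin n → ℤ)}

theorem isCompact_liftedHull (ν : {a // a ∈ S} → ℝ) : IsCompact (liftedHull S ν) :=
  (Set.finite_range _).isCompact_convexHull ℝ

theorem image_fst_liftedHull (ν : {a // a ∈ S} → ℝ) :
    Prod.fst '' liftedHull S ν = convexHull ℝ (castZ '' (S : Set (Fin n → ℤ))) := by
  have := (LinearMap.fst ℝ (Fin n → ℝ) ℝ).image_convexHull
    (Set.range fun a : {a // a ∈ S} => (castZ (a : Fin n → ℤ), ν a))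
  rw [LinearMap.coe_fst] at this
  rw [liftedHull, this, ← Set.range_comp]
  congr 1
  ext x
  simp [Function.comp_def]

theorem lowerEnv_le {ν : {a // a ∈ S} → ℝ} {x : Fin n → ℝ} {t : ℝ}
    (h : (x, t) ∈ liftedHull S ν) : lowerEnv S ν x ≤ t := by
  refine csInf_le ?_ h
  refine (((isCompact_liftedHull ν).image continuous_snd).bddBelow).mono ?_
  exact fun s hs => ⟨(x, s), hs, rfl⟩

theorem mem_liftedHull_lowerEnv (ν : {a // a ∈ S} → ℝ) {x : Fin n → ℝ}
    (hx : x ∈ convexHull ℝ (castZ '' (S : Set (Fin n → ℤ)))) :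
    (x, lowerEnv S ν x) ∈ liftedHull S ν := by
  rw [← image_fst_liftedHull ν] at hx
  obtain ⟨⟨x', t⟩, ht, hx'⟩ := hx
  obtain rfl : x' = x := hx'
  have hclosed : IsClosed {s : ℝ | (x', s) ∈ liftedHull S ν} :=
    (isCompact_liftedHull ν).isClosed.preimage (Continuous.prodMk_right x')
  refine hclosed.csInf_mem ⟨t, ht⟩ ?_
  refine (((isCompact_liftedHull ν).image continuous_snd).bddBelow).mono ?_
  exact fun s hs => ⟨(x', s), hs, rfl⟩

/-- The lattice points spanning the epigraph, truncated at height `M`, of a lower envelope. -/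
def truncatedLift (S : Finset (Fin n → ℤ)) (ν : {a // a ∈ S} → ℤ) (M : ℤ)
    (s : {a // a ∈ S} × Bool) : (Fin n → ℤ) × ℤ :=
  (s.1, if s.2 then M else ν s.1)

/-- The epigraph, truncated at height `M`, of a lower envelope. -/
def truncatedEpigraph (S : Finset (Fin n → ℤ)) (ν : {a // a ∈ S} → ℤ) (M : ℤ) :
    Set ((Fin n → ℝ) × ℝ) :=
  convexHull ℝ (Set.range fun s => latticeEmb n (truncatedLift S ν M s))

theorem liftedHull_subset_truncatedEpigraph (ν : {a // a ∈ S} → ℤ) (M : ℤ) :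
    liftedHull S (fun a => (ν a : ℝ)) ⊆ truncatedEpigraph S ν M := by
  refine convexHull_mono ?_
  rintro _ ⟨a, rfl⟩
  exact ⟨(a, false), rfl⟩

theorem top_mem_truncatedEpigraph (ν : {a // a ∈ S} → ℤ) (M : ℤ) {x : Fin n → ℝ}
    (hx : x ∈ convexHull ℝ (castZ '' (S : Set (Fin n → ℤ)))) :
    (x, (M : ℝ)) ∈ truncatedEpigraph S ν M := by
  have h := mem_liftedHull_lowerEnv (fun _ : {a // a ∈ S} => (M : ℝ)) hx
  have hM : liftedHull S (fun _ => (M : ℝ)) ⊆ {p | p.2 = M} := by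
    refine convexHull_min ?_ ((convex_singleton (M : ℝ)).linear_preimage
      (LinearMap.snd ℝ (Fin n → ℝ) ℝ))
    rintro _ ⟨a, rfl⟩
    rfl
  have hsub : liftedHull S (fun _ => (M : ℝ)) ⊆ truncatedEpigraph S ν M := by
    refine convexHull_mono ?_
    rintro _ ⟨a, rfl⟩
    exact ⟨(a, true), rfl⟩
  have h' : lowerEnv S (fun _ => (M : ℝ)) x = M := hM h
  rw [h'] at h
  exact hsub h

theorem exists_mem_liftedHull_of_mem_truncatedEpigraph {ν : {a // a ∈ S} → ℤ} {M : ℤ}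
    (hM : ∀ a, ν a ≤ M) {p : (Fin n → ℝ) × ℝ} (hp : p ∈ truncatedEpigraph S ν M) :
    p.2 ≤ M ∧ ∃ s ≤ p.2, (p.1, s) ∈ liftedHull S (fun a => (ν a : ℝ)) := by
  have hconv : Convex ℝ {p : (Fin n → ℝ) × ℝ |
      p.2 ≤ M ∧ ∃ s ≤ p.2, (p.1, s) ∈ liftedHull S (fun a => (ν a : ℝ))} := by
    rintro p ⟨hp, s, hs, hps⟩ q ⟨hq, r, hr, hqr⟩ a b ha hb hab
    refine ⟨?_, a * s + b * r, ?_, convex_convexHull ℝ _ hps hqr ha hb hab⟩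
    · exact convex_Iic (M : ℝ) hp hq ha hb hab
    · exact add_le_add (mul_le_mul_of_nonneg_left hs ha) (mul_le_mul_of_nonneg_left hr hb)
  refine convexHull_min ?_ hconv hp
  rintro _ ⟨⟨a, b⟩, rfl⟩
  have ha : (castZ (a : Fin n → ℤ), (ν a : ℝ)) ∈ liftedHull S (fun a => (ν a : ℝ)) :=
    subset_convexHull ℝ _ ⟨a, rfl⟩
  cases b
  · exact ⟨Int.cast_le.2 (hM a), ν a, le_rfl, ha⟩
  · exact ⟨le_rfl, ν a, Int.cast_le.2 (hM a), ha⟩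

end TruncatedEpigraph

section Slices

variable {n : ℕ} {ι : Type*} [Fintype ι]

theorem convex_minkowskiCombination {κ : ι → Type*} [∀ i, Fintype (κ i)]
    (f : ∀ i, κ i → (Fin n → ℤ) × ℤ) (t : ι → ℝ) : Convex ℝ (minkowskiCombination f t) := by
  refine Convex.linear_image ?_ (realCombination f).toLinearMap
  rintro x hx y hy a b ha hb hab
  refine ⟨fun i k => add_nonneg (mul_nonneg ha (hx.1 i k)) (mul_nonneg hb (hy.1 i k)),
    fun i => ?_⟩
  simp [Finset.sum_add_distrib, ← Finset.mul_sum, hx.2 i, hy.2 i, ← add_mul, hab]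

theorem mem_minkowskiCombination_indicator_iff [DecidableEq ι] {κ : ι → Type*}
    [∀ i, Fintype (κ i)]
    (f : ∀ i, κ i → (Fin n → ℤ) × ℤ) (J : Finset ι) (z : (Fin n → ℝ) × ℝ) :
    z ∈ minkowskiCombination f (fun i => if i ∈ J then 1 else 0) ↔
      ∃ p : ι → (Fin n → ℝ) × ℝ,
        (∀ i ∈ J, p i ∈ convexHull ℝ (Set.range fun s => latticeEmb n (f i s))) ∧
          ∑ i ∈ J, p i = z := by
  constructor
  · rintro ⟨x, hx, rfl⟩
    refine ⟨fun i => ∑ a, x i a • latticeEmb n (f i a), fun i hi => ?_, ?_⟩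
    · exact (mem_convexHull_range_iff_exists_weights _ _).2
        ⟨x i, hx.1 i, (hx.2 i).trans (if_pos hi), rfl⟩
    · rw [realCombination_apply]
      refine Finset.sum_subset (Finset.subset_univ J) fun i _ hi => ?_
      have h0 : ∑ a, x i a = 0 := (hx.2 i).trans (if_neg hi)
      rw [Finset.sum_eq_zero_iff_of_nonneg fun a _ => hx.1 i a] at h0
      exact Finset.sum_eq_zero fun a ha => by rw [h0 a ha, zero_smul]
  · rintro ⟨p, hp, rfl⟩
    simp_rw [mem_convexHull_range_iff_exists_weights] at hp
    choose! w hw hw1 hwp using hp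
    refine ⟨fun i a => if i ∈ J then w i a else 0, ⟨fun i a => ?_, fun i => ?_⟩, ?_⟩
    · beta_reduce
      split_ifs with hi
      exacts [hw i hi a, le_rfl]
    · by_cases hi : i ∈ J <;> simp [hi, hw1]
    · rw [realCombination_apply, ← Finset.sum_subset (Finset.subset_univ J)]
      · exact Finset.sum_congr rfl fun i hi => by simp [hi, ← hwp i hi]
      · intro i _ hi
        simp [hi]

variable {C : Fin (n + 1) → Finset (Fin n → ℤ)} {ν : ∀ i, {a // a ∈ C i} → ℤ} {M : ℤ}

/-- The Minkowski sum of the truncated epigraphs indexed by `J`. -/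
def epigraphSum (C : Fin (n + 1) → Finset (Fin n → ℤ)) (ν : ∀ i, {a // a ∈ C i} → ℤ) (M : ℤ)
    (J : Finset (Fin (n + 1))) : Set ((Fin n → ℝ) × ℝ) :=
  minkowskiCombination (fun i => truncatedLift (C i) (ν i) M) fun i => if i ∈ J then 1 else 0

theorem exists_sum_lowerEnv_le_of_mem_epigraphSum (hM : ∀ i a, ν i a ≤ M)
    {J : Finset (Fin (n + 1))} {x : Fin n → ℝ} {t : ℝ} (h : (x, t) ∈ epigraphSum C ν M J) :
    t ≤ J.card * M ∧ ∃ y : Fin (n + 1) → Fin n → ℝ,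
      (∀ i ∈ J, y i ∈ convexHull ℝ (castZ '' (C i : Set (Fin n → ℤ)))) ∧ ∑ i ∈ J, y i = x ∧
        ∑ i ∈ J, lowerEnv (C i) (fun a => (ν i a : ℝ)) (y i) ≤ t := by
  obtain ⟨p, hp, hpx⟩ := (mem_minkowskiCombination_indicator_iff _ _ _).1 h
  have hp' := fun i hi => exists_mem_liftedHull_of_mem_truncatedEpigraph (hM i) (hp i hi)
  obtain rfl : ∑ i ∈ J, (p i).1 = x := by rw [← Prod.fst_sum, hpx]
  obtain rfl : ∑ i ∈ J, (p i).2 = t := by rw [← Prod.snd_sum, hpx]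
  refine ⟨?_, fun i => (p i).1, fun i hi => ?_, rfl, Finset.sum_le_sum fun i hi => ?_⟩
  · rw [← nsmul_eq_mul]
    exact Finset.sum_le_card_nsmul _ _ _ fun i hi => (hp' i hi).1
  · obtain ⟨-, s, -, hs⟩ := hp' i hi
    rw [← image_fst_liftedHull fun a => (ν i a : ℝ)]
    exact ⟨_, hs, rfl⟩
  · obtain ⟨-, s, hs, hs'⟩ := hp' i hi
    exact (lowerEnv_le hs').trans hs

theorem sum_lowerEnv_mem_epigraphSum {J : Finset (Fin (n + 1))}
    {y : Fin (n + 1) → Fin n → ℝ}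
    (hy : ∀ i ∈ J, y i ∈ convexHull ℝ (castZ '' (C i : Set (Fin n → ℤ)))) :
    (∑ i ∈ J, y i, ∑ i ∈ J, lowerEnv (C i) (fun a => (ν i a : ℝ)) (y i)) ∈
      epigraphSum C ν M J := by
  refine (mem_minkowskiCombination_indicator_iff _ _ _).2
    ⟨fun i => (y i, lowerEnv (C i) (fun a => (ν i a : ℝ)) (y i)), fun i hi => ?_, ?_⟩
  · exact liftedHull_subset_truncatedEpigraph _ _ (mem_liftedHull_lowerEnv _ (hy i hi))
  · exact Prod.ext (by simp [Prod.fst_sum]) (by simp [Prod.snd_sum])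

theorem top_mem_epigraphSum {J : Finset (Fin (n + 1))} {y : Fin (n + 1) → Fin n → ℝ}
    (hy : ∀ i ∈ J, y i ∈ convexHull ℝ (castZ '' (C i : Set (Fin n → ℤ)))) :
    (∑ i ∈ J, y i, J.card * (M : ℝ)) ∈ epigraphSum C ν M J := by
  refine (mem_minkowskiCombination_indicator_iff _ _ _).2
    ⟨fun i => (y i, (M : ℝ)), fun i hi => top_mem_truncatedEpigraph _ _ (hy i hi), ?_⟩
  exact Prod.ext (by simp [Prod.fst_sum]) (by simp [Prod.snd_sum])

theorem mem_sum_convexHull_iff {J : Finset (Fin (n + 1))} {x : Fin n → ℝ} :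
    x ∈ ∑ i ∈ J, convexHull ℝ (castZ '' (C i : Set (Fin n → ℤ))) ↔
      ∃ y : Fin (n + 1) → Fin n → ℝ,
        (∀ i ∈ J, y i ∈ convexHull ℝ (castZ '' (C i : Set (Fin n → ℤ)))) ∧ ∑ i ∈ J, y i = x := by
  rw [Set.mem_finsetSum]
  exact ⟨fun ⟨y, hy, h⟩ => ⟨y, fun _ hi => hy hi, h⟩,
    fun ⟨y, hy, h⟩ => ⟨y, fun hi => hy _ hi, h⟩⟩

theorem isCompact_epigraphSum (C : Fin (n + 1) → Finset (Fin n → ℤ))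
    (ν : ∀ i, {a // a ∈ C i} → ℤ) (M : ℤ) (J : Finset (Fin (n + 1))) :
    IsCompact (epigraphSum C ν M J) :=
  isCompact_minkowskiCombination _ _

theorem slice_epigraphSum (hM : ∀ i a, ν i a ≤ M) {J : Finset (Fin (n + 1))} {x : Fin n → ℝ}
    (hx : x ∈ ∑ i ∈ J, convexHull ℝ (castZ '' (C i : Set (Fin n → ℤ)))) :
    Prod.mk x ⁻¹' epigraphSum C ν M J =
      Set.Icc (infConvOn J (fun i => convexHull ℝ (castZ '' (C i : Set (Fin n → ℤ))))
        (fun i => lowerEnv (C i) (fun a => (ν i a : ℝ))) x) (J.card * M) := by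
  obtain ⟨y, hy, hyx⟩ := mem_sum_convexHull_iff.1 hx
  have hKc := isCompact_epigraphSum C ν M J
  have htop : (J.card * (M : ℝ)) ∈ Prod.mk x ⁻¹' epigraphSum C ν M J :=
    hyx ▸ top_mem_epigraphSum hy
  have hbdd : BddBelow (Prod.mk x ⁻¹' epigraphSum C ν M J) :=
    (hKc.image continuous_snd).bddBelow.mono fun s hs => Set.mem_image_of_mem Prod.snd hs
  have hsub : {t | ∃ y : Fin (n + 1) → Fin n → ℝ,
      (∀ i ∈ J, y i ∈ convexHull ℝ (castZ '' (C i : Set (Fin n → ℤ)))) ∧ (∑ i ∈ J, y i) = x ∧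
        (∑ i ∈ J, lowerEnv (C i) (fun a => (ν i a : ℝ)) (y i)) = t} ⊆
      Prod.mk x ⁻¹' epigraphSum C ν M J := by
    rintro _ ⟨y, hy, rfl, rfl⟩
    exact sum_lowerEnv_mem_epigraphSum hy
  have hinf : infConvOn J (fun i => convexHull ℝ (castZ '' (C i : Set (Fin n → ℤ))))
      (fun i => lowerEnv (C i) (fun a => (ν i a : ℝ))) x =
        sInf (Prod.mk x ⁻¹' epigraphSum C ν M J) := by
    refine le_antisymm (le_csInf ⟨_, htop⟩ fun s hs => ?_)
      (csInf_le_csInf hbdd ⟨_, y, hy, hyx, rfl⟩ hsub)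
    obtain ⟨-, z, hz, hzx, hle⟩ := exists_sum_lowerEnv_le_of_mem_epigraphSum hM hs
    exact (csInf_le (hbdd.mono hsub) ⟨z, hz, hzx, rfl⟩).trans hle
  rw [hinf]
  refine Set.Subset.antisymm (fun s hs => ⟨csInf_le hbdd hs,
    (exists_sum_lowerEnv_le_of_mem_epigraphSum hM hs).1⟩) ?_
  have hmin : sInf (Prod.mk x ⁻¹' epigraphSum C ν M J) ∈ Prod.mk x ⁻¹' epigraphSum C ν M J :=
    (hKc.isClosed.preimage (Continuous.prodMk_right x)).csInf_mem ⟨_, htop⟩ hbdd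
  have hconv : Convex ℝ (Prod.mk x ⁻¹' epigraphSum C ν M J) := by
    intro s hs r hr a b ha hb hab
    have := convex_minkowskiCombination _ _ hs hr ha hb hab
    rw [Prod.smul_mk, Prod.smul_mk, Prod.mk_add_mk, ← add_smul, hab, one_smul] at this
    exact this
  exact hconv.ordConnected.out hmin htop

theorem slice_epigraphSum_of_notMem (hM : ∀ i a, ν i a ≤ M) {J : Finset (Fin (n + 1))}
    {x : Fin n → ℝ} (hx : x ∉ ∑ i ∈ J, convexHull ℝ (castZ '' (C i : Set (Fin n → ℤ)))) :
    Prod.mk x ⁻¹' epigraphSum C ν M J = ∅ := by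
  refine Set.eq_empty_of_forall_notMem fun t ht => hx ?_
  obtain ⟨-, y, hy, hyx, -⟩ := exists_sum_lowerEnv_le_of_mem_epigraphSum hM ht
  exact mem_sum_convexHull_iff.2 ⟨y, hy, hyx⟩

theorem isCompact_sum_convexHull (C : Fin (n + 1) → Finset (Fin n → ℤ))
    (J : Finset (Fin (n + 1))) :
    IsCompact (∑ i ∈ J, convexHull ℝ (castZ '' (C i : Set (Fin n → ℤ)))) := by
  induction J using Finset.induction_on with
  | empty => exact isCompact_singleton
  | insert i J hi ih =>
    rw [Finset.sum_insert hi]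
    exact (((C i).finite_toSet.image _).isCompact_convexHull ℝ).add ih

/-- The integral of an inf-convolution of lower envelopes in terms of the volume of the
Minkowski sum of their truncated epigraphs. -/
theorem setIntegral_infConvOn_lowerEnv (hM : ∀ i a, ν i a ≤ M) (J : Finset (Fin (n + 1))) :
    ∫ x in ∑ i ∈ J, convexHull ℝ (castZ '' (C i : Set (Fin n → ℤ))),
      infConvOn J (fun i => convexHull ℝ (castZ '' (C i : Set (Fin n → ℤ))))
        (fun i => lowerEnv (C i) (fun a => (ν i a : ℝ))) x =
      (∫ _ in ∑ i ∈ J, convexHull ℝ (castZ '' (C i : Set (Fin n → ℤ))), (J.card * M : ℝ)) -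
        (volume (epigraphSum C ν M J)).toReal := by
  set A := ∑ i ∈ J, convexHull ℝ (castZ '' (C i : Set (Fin n → ℤ)))
  have hAc : IsCompact A := isCompact_sum_convexHull C J
  have hKc := isCompact_epigraphSum C ν M J
  have hmeas : Measurable fun x => volume (Prod.mk x ⁻¹' epigraphSum C ν M J) :=
    measurable_measure_prodMk_left hKc.measurableSet
  have hvol : volume (epigraphSum C ν M J) =
      ∫⁻ x in A, volume (Prod.mk x ⁻¹' epigraphSum C ν M J) := by
    rw [Measure.volume_eq_prod, Measure.prod_apply hKc.measurableSet,
      ← lintegral_indicator hAc.measurableSet]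
    refine lintegral_congr fun x => ?_
    by_cases hx : x ∈ A
    · rw [Set.indicator_of_mem hx]
    · rw [Set.indicator_of_notMem hx, slice_epigraphSum_of_notMem hM hx, measure_empty]
  have hfin : ∫⁻ x in A, volume (Prod.mk x ⁻¹' epigraphSum C ν M J) ≠ ⊤ :=
    hvol ▸ hKc.measure_ne_top
  rw [hvol, ← integral_toReal hmeas.aemeasurable (ae_lt_top hmeas hfin), ← integral_sub]
  · refine setIntegral_congr_fun hAc.measurableSet fun x hx => ?_
    have hx' := slice_epigraphSum hM hx
    have hne : (Prod.mk x ⁻¹' epigraphSum C ν M J).Nonempty := by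
      obtain ⟨y, hy, rfl⟩ := mem_sum_convexHull_iff.1 hx
      exact ⟨_, top_mem_epigraphSum hy⟩
    rw [hx', Set.nonempty_Icc] at hne
    simp only [hx', Real.volume_Icc, ENNReal.toReal_ofReal (sub_nonneg.2 hne), sub_sub_cancel]
  · exact integrableOn_const hAc.measure_ne_top
  · exact integrable_toReal_of_lintegral_ne_top hmeas.aemeasurable hfin

theorem infConvOn_lowerEnv_zero {J : Finset (Fin (n + 1))} {x : Fin n → ℝ}
    (hx : x ∈ ∑ i ∈ J, convexHull ℝ (castZ '' (C i : Set (Fin n → ℤ)))) :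
    infConvOn J (fun i => convexHull ℝ (castZ '' (C i : Set (Fin n → ℤ))))
      (fun i => lowerEnv (C i) fun _ => 0) x = 0 := by
  have hzero : ∀ i, ∀ y ∈ convexHull ℝ (castZ '' (C i : Set (Fin n → ℤ))),
      lowerEnv (C i) (fun _ => 0) y = 0 := fun i y hy => by
    have hsub : liftedHull (C i) (fun _ => 0) ⊆ {p | p.2 = 0} := by
      refine convexHull_min ?_ ((convex_singleton (0 : ℝ)).linear_preimage
        (LinearMap.snd ℝ (Fin n → ℝ) ℝ))
      rintro _ ⟨a, rfl⟩
      rfl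
    exact hsub (mem_liftedHull_lowerEnv _ hy)
  obtain ⟨y, hy, hyx⟩ := mem_sum_convexHull_iff.1 hx
  refine (congrArg sInf ?_).trans (csInf_singleton (0 : ℝ))
  ext t
  constructor
  · rintro ⟨z, hz, -, rfl⟩
    exact Finset.sum_eq_zero fun i hi => hzero i _ (hz i hi)
  · rintro rfl
    exact ⟨y, hy, hyx, Finset.sum_eq_zero fun i hi => hzero i _ (hy i hi)⟩

theorem setIntegral_infConvOn_eq_volume_sub (hM : ∀ i a, ν i a ≤ M) (hM0 : 0 ≤ M)
    (J : Finset (Fin (n + 1))) :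
    ∫ x in ∑ i ∈ J, convexHull ℝ (castZ '' (C i : Set (Fin n → ℤ))),
      infConvOn J (fun i => convexHull ℝ (castZ '' (C i : Set (Fin n → ℤ))))
        (fun i => lowerEnv (C i) (fun a => (ν i a : ℝ))) x =
      (volume (epigraphSum C (fun _ _ => 0) M J)).toReal -
        (volume (epigraphSum C ν M J)).toReal := by
  have h := setIntegral_infConvOn_lowerEnv (C := C) (ν := fun _ _ => 0) (fun _ _ => hM0) J
  rw [setIntegral_congr_fun (g := fun _ => (0 : ℝ)) (isCompact_sum_convexHull C J).measurableSet
    fun x hx => by simpa using infConvOn_lowerEnv_zero hx, integral_zero, eq_comm,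
    sub_eq_zero] at h
  rw [setIntegral_infConvOn_lowerEnv hM, h]

end Slices

/-- The mixed integral of lattice convex piecewise affine functions (lower envelopes of
integral liftings of finite sets of lattice points) is an integer. -/
theorem stmt15 (n : ℕ) (C : Fin (n + 1) → Finset (Fin n → ℤ)) (hC : ∀ i, (C i).Nonempty)
    (ν : ∀ i : Fin (n + 1), {a // a ∈ C i} → ℤ) :
    ∃ k : ℤ, MI n (fun i => convexHull ℝ (castZ '' ↑(C i)))
      (fun i => lowerEnv (C i) (fun a => (ν i a : ℝ))) = k := by
  have : ∀ i, Nonempty ({a // a ∈ C i} × Bool) := fun i =>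
    ⟨⟨(hC i).choose, (hC i).choose_spec⟩, false⟩
  obtain ⟨M, hM0, hM⟩ : ∃ M : ℤ, 0 ≤ M ∧ ∀ i a, ν i a ≤ M := by
    refine ⟨∑ i, ∑ a, |ν i a|, by positivity, fun i a => (le_abs_self _).trans ?_⟩
    exact (Finset.single_le_sum (f := fun a => |ν i a|) (fun _ _ => abs_nonneg _)
      (Finset.mem_univ a)).trans (Finset.single_le_sum (f := fun i => ∑ a, |ν i a|)
        (fun _ _ => by positivity) (Finset.mem_univ i))
  obtain ⟨k, hk⟩ := exists_int_sum_sign_volume (Fintype.card_fin _)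
    fun i => truncatedLift (C i) (fun _ => 0) M
  obtain ⟨l, hl⟩ := exists_int_sum_sign_volume (Fintype.card_fin _)
    fun i => truncatedLift (C i) (ν i) M
  refine ⟨k - l, ?_⟩
  rw [Int.cast_sub, ← hk, ← hl, ← Finset.sum_sub_distrib, MI, Finset.sum_filter_of_ne]
  · refine Finset.sum_congr rfl fun J _ => ?_
    rw [setIntegral_infConvOn_eq_volume_sub hM hM0, mul_sub]
    rfl
  · intro J _ hJ
    rw [Finset.nonempty_iff_ne_empty]
    rintro rfl
    have h0 : infConvOn ∅ (fun i => convexHull ℝ (castZ '' (C i : Set (Fin n → ℤ))))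
        (fun i => lowerEnv (C i) (fun a => (ν i a : ℝ))) = fun _ => 0 := by
      ext x
      by_cases hx : 0 = x <;> simp [infConvOn, hx]
    exact hJ (by simp [h0])
end
end
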